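/- Let X be an alphabet having n ≥ 2 letters and define A(n) = ⌊9n³√(n log n)⌋. Let g, h: X* → X* be primitive morphisms and let x ∈ X be a letter such that g^ω(x) and h^ω(x) exist. Define f₁ = g^{2n−2}∘h^{2n−2} and f₂ = h^{2n−2}∘g^{2n−2}. Then g^ω(x) = h^ω(x) if and only if BAL(f₁, f₂) < ∞ and f₁^{A(n)}(x) ∈ COMP(f₁, f₂). -/

import Mathlib

open Filter Set

variable {X : Type*}

/-- Apply the morphism with letter images `g` to a word. -/
def applyM (g : X → List X) (w : List X) : List X := w.flatMap g

/-- `iterM g k w` is `g^k(w)`. -/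
def iterM (g : X → List X) (k : ℕ) (w : List X) : List X := (applyM g)^[k] w

/-- The letter map of the composition `g ∘ h` (first `h`, then `g`). -/
def compM (g h : X → List X) : X → List X := fun a => applyM g (h a)

/-- The letter map of the power `g^k`. -/
def powM (g : X → List X) (k : ℕ) : X → List X := fun a => iterM g k [a]

/-- A morphism is primitive if some power maps every letter to a word containing every letter. -/
def Primitive (g : X → List X) : Prop := ∃ k : ℕ, 0 < k ∧ ∀ a b : X, a ∈ iterM g k [b]

/-- `Mg g` is the maximal length of the image of a letter. -/
def Mg [Fintype X] (g : X → List X) : ℕ := Finset.univ.sup fun x => (g x).length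

/-- A morphism is growing if the lengths of iterated images of every letter tend to infinity. -/
def Growing (g : X → List X) : Prop :=
  ∀ x : X, Tendsto (fun i => (iterM g i [x]).length) atTop atTop

/-- `w` is a (finite) prefix of the infinite word `s`. -/
def IsPrefI (w : List X) (s : ℕ → X) : Prop := ∀ i (h : i < w.length), w[i]'h = s i

/-- `v` is a factor of the infinite word `s`. -/
def IsFactorI (v : List X) (s : ℕ → X) : Prop :=
  ∃ j : ℕ, ∀ i (h : i < v.length), v[i]'h = s (j + i)

/-- `g^ω(x)` exists. -/
def OmegaExists (g : X → List X) (x : X) : Prop :=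
  [x] <+: g x ∧ Tendsto (fun i => (iterM g i [x]).length) atTop atTop

/-- `s = g^ω(x)`. -/
def IsOmega (g : X → List X) (x : X) (s : ℕ → X) : Prop :=
  OmegaExists g x ∧ ∀ i : ℕ, IsPrefI (iterM g i [x]) s

/-- `s = u^ω` for the nonempty word `u`. -/
def IsPeriodicWord (s : ℕ → X) (u : List X) : Prop :=
  u ≠ [] ∧ ∀ (i : ℕ) (h : i % u.length < u.length), s i = u[i % u.length]'h

/-- A morphism is looping. -/
def Looping (g : X → List X) : Prop :=
  ∃ k : ℕ, 0 < k ∧ ∃ x : X, ∃ u : List X, ∃ s : ℕ → X,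
    IsOmega (powM g k) x s ∧ IsPeriodicWord s u

/-- A morphism is loop-free if it is not looping. -/
def LoopFree (g : X → List X) : Prop := ¬ Looping g

/-- `p` is a period of `u`. -/
def HasPeriod (u : List X) (p : ℕ) : Prop :=
  0 < p ∧ ∀ i : ℕ, i + p < u.length → u[i + p]? = u[i]?

/-- The smallest period of `u`. -/
noncomputable def PER (u : List X) : ℕ := sInf {p | HasPeriod u p}

/-- A primitive word: nonempty and not a proper power of a shorter word. -/
def PrimitiveWord (u : List X) : Prop :=
  u ≠ [] ∧ ¬∃ (v : List X) (j : ℕ), 2 ≤ j ∧ v.length < u.length ∧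
    u = (List.replicate j v).flatten

/-- `COMP g h` : the set of words whose images under `g` and `h` are prefix-comparable. -/
def COMP (g h : X → List X) : Set (List X) :=
  {w | ∃ u₁ u₂ : List X, applyM g w ++ u₁ = applyM h w ++ u₂}

/-- `BAL g h`. -/
noncomputable def BAL (g h : X → List X) : ℕ∞ :=
  ⨆ (x : X) (k : ℕ),
    ((((applyM g (iterM g k [x])).length : ℤ) -
      ((applyM h (iterM g k [x])).length : ℤ)).natAbs : ℕ∞)

/-- The set of factors of length `q` of the word `w`. -/
def Fq (q : ℕ) (w : List X) : Set (List X) := {v | v.length = q ∧ v <:+: w}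

/-- The set of factors of length `q` of words of `L`. -/
def FqL (q : ℕ) (L : Set (List X)) : Set (List X) := ⋃ w ∈ L, Fq q w

/-- `A n = ⌊9 n³ √(n log n)⌋`. -/
noncomputable def Abound (n : ℕ) : ℕ := ⌊9 * (n : ℝ)^3 * Real.sqrt (n * Real.log n)⌋₊

/-! ### Basic lemmas on words -/

lemma applyM_append (g : X → List X) (u v : List X) :
    applyM g (u ++ v) = applyM g u ++ applyM g v := by simp [applyM]

lemma applyM_nil (g : X → List X) : applyM g [] = [] := rfl

lemma applyM_single (g : X → List X) (a : X) : applyM g [a] = g a := by simp [applyM]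

lemma applyM_cons (g : X → List X) (a : X) (w : List X) :
    applyM g (a :: w) = g a ++ applyM g w := by simp [applyM]

lemma iterM_zero (g : X → List X) (w : List X) : iterM g 0 w = w := rfl

lemma iterM_succ (g : X → List X) (k : ℕ) (w : List X) :
    iterM g (k + 1) w = applyM g (iterM g k w) := by
  simp [iterM, Function.iterate_succ_apply']

lemma iterM_succ' (g : X → List X) (k : ℕ) (w : List X) :
    iterM g (k + 1) w = iterM g k (applyM g w) := by
  simp [iterM, Function.iterate_succ_apply]

lemma iterM_add (g : X → List X) (k l : ℕ) (w : List X) :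
    iterM g (k + l) w = iterM g k (iterM g l w) := by
  simp [iterM, Function.iterate_add_apply]

lemma iterM_append (g : X → List X) (k : ℕ) (u v : List X) :
    iterM g k (u ++ v) = iterM g k u ++ iterM g k v := by
  induction k with
  | zero => rfl
  | succ k ih => rw [iterM_succ, iterM_succ, iterM_succ, ih, applyM_append]

lemma iterM_nil (g : X → List X) (k : ℕ) : iterM g k [] = [] := by
  induction k with
  | zero => rfl
  | succ k ih => rw [iterM_succ, ih, applyM_nil]

lemma applyM_powM (g : X → List X) (k : ℕ) (w : List X) :
    applyM (powM g k) w = iterM g k w := by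
  induction w with
  | nil => rw [iterM_nil, applyM_nil]
  | cons a w ih =>
    rw [applyM_cons, ih, powM, ← iterM_append]; rfl

lemma applyM_compM (g h : X → List X) (w : List X) :
    applyM (compM g h) w = applyM g (applyM h w) := by
  induction w with
  | nil => rfl
  | cons a w ih =>
    rw [applyM_cons, applyM_cons, ih, applyM_append]; rfl

lemma applyM_prefix (g : X → List X) {u v : List X} (h : u <+: v) :
    applyM g u <+: applyM g v := by
  obtain ⟨r, rfl⟩ := h
  rw [applyM_append]; exact List.prefix_append _ _

lemma iterM_prefix (g : X → List X) (k : ℕ) {u v : List X} (h : u <+: v) :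
    iterM g k u <+: iterM g k v := by
  obtain ⟨r, rfl⟩ := h
  rw [iterM_append]; exact List.prefix_append _ _

lemma mem_applyM (g : X → List X) (w : List X) (b : X) :
    b ∈ applyM g w ↔ ∃ a ∈ w, b ∈ g a := by simp [applyM]

/-! ### Prefixes of infinite words -/

def pre (s : ℕ → X) (t : ℕ) : List X := (List.range t).map s

def pos (α : X → List X) (s : ℕ → X) (t : ℕ) : ℕ := (applyM α (pre s t)).length

def FixW (α : X → List X) (s : ℕ → X) : Prop := ∀ t, applyM α (pre s t) = pre s (pos α s t)

lemma pre_length (s : ℕ → X) (t : ℕ) : (pre s t).length = t := by simp [pre]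

lemma pre_zero (s : ℕ → X) : pre s 0 = [] := rfl

lemma pre_succ (s : ℕ → X) (t : ℕ) : pre s (t + 1) = pre s t ++ [s t] := by
  simp [pre, List.range_succ]

lemma pre_one (s : ℕ → X) : pre s 1 = [s 0] := rfl

lemma pre_getElem? (s : ℕ → X) (t i : ℕ) (h : i < t) : (pre s t)[i]? = some (s i) := by
  simp [pre, h]

lemma pre_prefix (s : ℕ → X) {a b : ℕ} (h : a ≤ b) : pre s a <+: pre s b := by
  obtain ⟨c, rfl⟩ := Nat.exists_eq_add_of_le h
  unfold pre
  rw [List.range_add, List.map_append]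
  exact List.prefix_append _ _

lemma eq_pre_of_prefix (s : ℕ → X) {w : List X} {b : ℕ} (h : w <+: pre s b) :
    w = pre s w.length := by
  have hl := h.length_le
  rw [pre_length] at hl
  have h2 := pre_prefix s hl
  exact List.IsPrefix.eq_of_length (List.prefix_of_prefix_length_le h h2 (by rw [pre_length]))
    (by rw [pre_length])

lemma pre_take (s : ℕ → X) {a b : ℕ} (h : a ≤ b) : (pre s b).take a = pre s a := by
  have h1 : (pre s b).take a <+: pre s b := List.take_prefix _ _
  have := eq_pre_of_prefix s h1
  rw [this]; simp [pre_length, h]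

lemma isPrefI_iff (w : List X) (s : ℕ → X) : IsPrefI w s ↔ w = pre s w.length := by
  constructor
  · intro h
    apply List.ext_getElem
    · rw [pre_length]
    · intro i h1 h2
      rw [h i h1]; simp [pre]
  · intro h i hi
    have := pre_getElem? s w.length i hi
    rw [← h, List.getElem?_eq_getElem hi] at this
    simpa using this

lemma pos_zero (α : X → List X) (s : ℕ → X) : pos α s 0 = 0 := rfl

lemma pos_succ (α : X → List X) (s : ℕ → X) (t : ℕ) :
    pos α s (t + 1) = pos α s t + (α (s t)).length := by
  simp [pos, pre_succ, applyM_append, applyM_single]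

lemma pos_one (α : X → List X) (s : ℕ → X) : pos α s 1 = (α (s 0)).length := by
  rw [pos_succ, pos_zero, Nat.zero_add]

lemma pos_mono (α : X → List X) (s : ℕ → X) : Monotone (pos α s) :=
  monotone_nat_of_le_succ fun t => by rw [pos_succ]; omega

lemma pos_ge (α : X → List X) (s : ℕ → X) (h : ∀ a, 1 ≤ (α a).length) (t : ℕ) :
    t ≤ pos α s t := by
  induction t with
  | zero => omega
  | succ t ih => rw [pos_succ]; have := h (s t); omega

lemma exists_pos (α : X → List X) (s : ℕ → X) (h : ∀ a, 1 ≤ (α a).length) (y : ℕ) :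
    ∃ t z, y = pos α s t + z ∧ z < (α (s t)).length := by
  induction y with
  | zero => exact ⟨0, 0, by simp [pos_zero], h _⟩
  | succ y ih =>
    obtain ⟨t, z, rfl, hz⟩ := ih
    by_cases hz' : z + 1 < (α (s t)).length
    · exact ⟨t, z + 1, by omega, hz'⟩
    · exact ⟨t + 1, 0, by rw [pos_succ]; omega, h _⟩

/-- The block of `α (s t)` inside `α (pre s T)`. -/
lemma block_getElem? (α : X → List X) (s : ℕ → X) {t T z : ℕ} (ht : t < T)
    (hz : z < (α (s t)).length) :
    (applyM α (pre s T))[pos α s t + z]? = (α (s t))[z]? := by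
  have h1 : applyM α (pre s (t + 1)) <+: applyM α (pre s T) :=
    applyM_prefix α (pre_prefix s ht)
  obtain ⟨r, hr⟩ := h1
  rw [← hr, pre_succ, applyM_append, applyM_single, List.append_assoc,
    List.getElem?_append_right (by unfold pos; omega)]
  have : pos α s t + z - (applyM α (pre s t)).length = z := by unfold pos; omega
  rw [this, List.getElem?_append_left hz]

lemma FixW.blk {α : X → List X} {s : ℕ → X} (h : FixW α s) {t z : ℕ}
    (hz : z < (α (s t)).length) : (α (s t))[z]? = some (s (pos α s t + z)) := by
  rw [← block_getElem? α s (Nat.lt_succ_self t) hz, h]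
  apply pre_getElem?
  rw [Nat.succ_eq_add_one, pos_succ]; omega

lemma FixW.eq_of {α : X → List X} {s : ℕ → X} (h : FixW α s) {t t' z : ℕ} (ht : s t = s t')
    (hz : z < (α (s t)).length) : s (pos α s t + z) = s (pos α s t' + z) := by
  have h1 := h.blk hz
  have h2 := h.blk (t := t') (z := z) (ht ▸ hz)
  rw [ht] at h1
  rw [h1] at h2
  simpa using h2

lemma FixW.eq_of₂ {α : X → List X} {s : ℕ → X} (h : FixW α s) {t t' z : ℕ} (ht : s t = s t')
    (ht2 : s (t + 1) = s (t' + 1))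
    (hz : z < (α (s t)).length + (α (s (t + 1))).length) :
    s (pos α s t + z) = s (pos α s t' + z) := by
  by_cases hz' : z < (α (s t)).length
  · exact h.eq_of ht hz'
  · have h1 := h.eq_of (z := z - (α (s t)).length) ht2 (by omega)
    rw [pos_succ, pos_succ] at h1
    have e1 : pos α s t + (α (s t)).length + (z - (α (s t)).length) = pos α s t + z := by omega
    have e2 : pos α s t' + (α (s t')).length + (z - (α (s t)).length) = pos α s t' + z := by
      rw [← ht]; omega
    rwa [e1, e2] at h1

lemma fix_of_blk {α : X → List X} {s : ℕ → X}
    (h : ∀ t z, z < (α (s t)).length → (α (s t))[z]? = some (s (pos α s t + z))) :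
    FixW α s := by
  intro t
  induction t with
  | zero => rfl
  | succ t ih =>
    apply List.ext_getElem?
    intro i
    by_cases hi : i < pos α s (t + 1)
    · rw [pre_getElem? _ _ _ hi, pre_succ, applyM_append, applyM_single]
      by_cases hi' : i < pos α s t
      · rw [List.getElem?_append_left hi', ih, pre_getElem? _ _ _ hi']
      · rw [List.getElem?_append_right (by unfold pos at hi'; omega)]
        change (α (s t))[i - pos α s t]? = _
        rw [pos_succ] at hi
        rw [h t (i - pos α s t) (by omega)]
        congr 2; omega
    · rw [List.getElem?_eq_none (by unfold pos at hi; omega),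
        List.getElem?_eq_none (by rw [pre_length]; omega)]

/-- It suffices to check the fixed point property on arbitrarily long prefixes. -/
lemma fix_of_long {α : X → List X} {s : ℕ → X}
    (h : ∀ t, ∃ t', t ≤ t' ∧ ∃ b, applyM α (pre s t') <+: pre s b) : FixW α s := by
  intro t
  obtain ⟨t', ht, b, hb⟩ := h t
  exact eq_pre_of_prefix s ((applyM_prefix α (pre_prefix s ht)).trans hb)

lemma pos_compM {α β : X → List X} {s : ℕ → X} (hβ : FixW β s) (t : ℕ) :
    pos (compM α β) s t = pos α s (pos β s t) := by
  unfold pos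
  rw [applyM_compM, hβ t, pre_length]

lemma FixW.comp {α β : X → List X} {s : ℕ → X} (hα : FixW α s) (hβ : FixW β s) :
    FixW (compM α β) s := by
  intro t
  rw [pos_compM hβ, applyM_compM, hβ t, hα]

lemma powM_zero_apply (f : X → List X) (a : X) : powM f 0 a = [a] := rfl

lemma powM_succ (f : X → List X) (k : ℕ) : powM f (k + 1) = compM f (powM f k) := by
  funext a; simp [powM, compM, iterM_succ]

lemma powM_add (f : X → List X) (k l : ℕ) : powM f (k + l) = compM (powM f k) (powM f l) := by
  funext a; simp [powM, compM, iterM_add, applyM_powM]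

lemma FixW.pow {f : X → List X} {s : ℕ → X} (h : FixW f s) (k : ℕ) : FixW (powM f k) s := by
  induction k with
  | zero =>
    intro t
    have : applyM (powM f 0) (pre s t) = pre s t := by rw [applyM_powM]; rfl
    unfold pos
    rw [this, pre_length]
  | succ k ih => rw [powM_succ]; exact h.comp ih

lemma FixW.iter_pre {f : X → List X} {s : ℕ → X} (h : FixW f s) (k t : ℕ) :
    iterM f k (pre s t) = pre s (pos (powM f k) s t) := by
  rw [← applyM_powM]; exact h.pow k t

/-- pairs of letters -/
lemma applyM_length_ge (g : X → List X) (hg : ∀ a, 1 ≤ (g a).length) (w : List X) :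
    w.length ≤ (applyM g w).length := by
  induction w with
  | nil => simp [applyM]
  | cons a w ih => rw [applyM_cons]; have := hg a; simp; omega

lemma iterM_length_ge (g : X → List X) (hg : ∀ a, 1 ≤ (g a).length) (k : ℕ) (w : List X) :
    w.length ≤ (iterM g k w).length := by
  induction k with
  | zero => rfl
  | succ k ih => rw [iterM_succ]; exact ih.trans (applyM_length_ge g hg _)

lemma length_le_of_mem (g : X → List X) {a : X} {w : List X} (h : a ∈ w) :
    (g a).length ≤ (applyM g w).length := by
  obtain ⟨u, v, rfl⟩ := List.append_of_mem h
  rw [applyM_append, applyM_cons]; simp; omega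

/-! ### Existence of the infinite word -/

lemma exists_omega (f : X → List X) (x : X) (hx : [x] <+: f x)
    (hl : ∀ N, ∃ k, N ≤ (iterM f k [x]).length) :
    ∃ s : ℕ → X, s 0 = x ∧ FixW f s ∧ ∀ k, iterM f k [x] = pre s (iterM f k [x]).length := by
  have hch : ∀ k, iterM f k [x] <+: iterM f (k + 1) [x] := fun k => by
    rw [iterM_succ']; apply iterM_prefix; rwa [applyM_single]
  have hch2 : ∀ k l, k ≤ l → iterM f k [x] <+: iterM f l [x] := by
    intro k l hkl
    induction l, hkl using Nat.le_induction with
    | base => exact List.prefix_refl _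
    | succ l _ ih => exact ih.trans (hch l)
  choose K hK using fun N => hl (N + 1)
  let s : ℕ → X := fun i => (iterM f (K i) [x])[i]'(hK i)
  have key : ∀ k, iterM f k [x] = pre s (iterM f k [x]).length := by
    intro k
    rw [← isPrefI_iff]
    intro i hi
    have e1 := List.IsPrefix.getElem (hch2 k (max k (K i)) (le_max_left _ _)) hi
    have e2 := List.IsPrefix.getElem (hch2 (K i) (max k (K i)) (le_max_right _ _)) (hK i)
    rw [e1]; exact e2.symm
  refine ⟨s, ?_, ?_, key⟩
  · have := key 0
    have h2 := congrArg List.head? this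
    simpa [iterM_zero, pre] using h2.symm
  · apply fix_of_long
    intro t
    obtain ⟨k, hk⟩ := hl t
    refine ⟨_, hk, (iterM f (k+1) [x]).length, ?_⟩
    rw [← key k, ← key (k + 1), iterM_succ]

/-! ### Synchronization -/

/-- difference of positions -/
def dlt (α β : X → List X) (s : ℕ → X) (t : ℕ) : ℤ := (pos α s t : ℤ) - pos β s t

lemma dlt_succ (α β : X → List X) (s : ℕ → X) (t : ℕ) :
    dlt α β s (t + 1) = dlt α β s t + (((α (s t)).length : ℤ) - (β (s t)).length) := by
  unfold dlt; rw [pos_succ, pos_succ]; push_cast; ring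

lemma consistent_extend (α β : X → List X) (s : ℕ → X) (T : ℕ)
    (hpair : ∀ t, ∃ t0, t0 + 1 < T ∧ s t0 = s t ∧ s (t0 + 1) = s (t + 1))
    (hc : ∀ t < T, ∀ t' < T, s t = s t' → dlt α β s t = dlt α β s t') :
    ∀ t, ∀ t0 < T, s t0 = s t → dlt α β s t = dlt α β s t0 := by
  intro t
  induction t with
  | zero =>
    intro t0 h0 he
    exact hc 0 (by omega) t0 h0 he.symm
  | succ t ih =>
    intro t1 h1 he
    obtain ⟨t0, h0, e0, e1⟩ := hpair t
    have := ih t0 (by omega) e0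
    rw [dlt_succ, this, ← e0, ← dlt_succ]
    exact hc _ h0 _ h1 (by rw [e1, he])

lemma period_window (α β : X → List X) (s : ℕ → X) (T D : ℕ) (hα : FixW α s)
    (hcomp : ∀ t < T, ∀ z < (β (s t)).length, pos β s t + z < pos α s T →
      (β (s t))[z]? = some (s (pos β s t + z)))
    (hD : ∀ t ≤ T, |dlt α β s t| ≤ D) (t t' : ℕ) (ht : t < T) (ht' : t' < T)
    (he : s t = s t') (hlt : dlt α β s t < dlt α β s t') (z : ℕ) (hz : D ≤ z)
    (hz2 : z + 3 * D < (α (s t)).length) :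
    s (pos α s t + z) = s (pos α s t + z + (dlt α β s t' - dlt α β s t).toNat) := by
  have a1 := abs_le.1 (hD t ht.le)
  have a2 := abs_le.1 (hD t' ht'.le)
  have a3 := abs_le.1 (hD (t + 1) ht)
  have s1 := dlt_succ α β s t
  have e1 := pos_succ α s t
  have e2 := pos_succ α s t'
  have m1 := pos_mono α s (show t + 1 ≤ T from ht)
  have m2 := pos_mono α s (show t' + 1 ≤ T from ht')
  have he' : (α (s t)).length = (α (s t')).length := by rw [he]
  have heb : (β (s t)).length = (β (s t')).length := by rw [he]
  obtain ⟨q, hq⟩ : ∃ q : ℕ, (q : ℤ) = z + dlt α β s t' := ⟨(z + dlt α β s t').toNat, by omega⟩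
  have d1 : dlt α β s t = (pos α s t : ℤ) - pos β s t := rfl
  have d2 : dlt α β s t' = (pos α s t' : ℤ) - pos β s t' := rfl
  have c1 := hcomp t ht q (by omega) (by omega)
  have c2 := hcomp t' ht' q (by omega) (by omega)
  rw [he, c2] at c1
  have c3 : s (pos β s t' + q) = s (pos β s t + q) := by simpa using c1
  have f1 := hα.eq_of he (z := z) (by omega)
  have g1 : pos β s t' + q = pos α s t' + z := by omega
  have g2 : pos β s t + q = pos α s t + z + (dlt α β s t' - dlt α β s t).toNat := by omega
  rw [g1, g2] at c3
  rw [f1, c3]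

lemma sync_aux (α β κ : X → List X) (s : ℕ → X) (T D : ℕ) (hα : FixW α s) (hκ : FixW κ s)
    (hpair : ∀ t, ∃ t0, t0 + 1 < T ∧ s t0 = s t ∧ s (t0 + 1) = s (t + 1))
    (hcomp : ∀ t < T, ∀ z < (β (s t)).length, pos β s t + z < pos α s T →
      (β (s t))[z]? = some (s (pos β s t + z)))
    (hD : ∀ t ≤ T, |dlt α β s t| ≤ D)
    (hκ1 : ∀ b, 1 ≤ (κ b).length) (hκD : ∀ b, 3 * D ≤ (κ b).length)
    (hblock : ∀ a, ∃ L R, α a = L ++ applyM κ (pre s T) ++ R ∧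
      3 * D ≤ L.length ∧ 3 * D ≤ R.length)
    (t t' : ℕ) (ht : t < T) (ht' : t' < T)
    (he : s t = s t') (hlt : dlt α β s t < dlt α β s t') :
    ∃ P, 0 < P ∧ P ≤ 2 * D ∧ ∀ y, s (y + P) = s y := by
  have a1 := abs_le.1 (hD t ht.le)
  have a2 := abs_le.1 (hD t' ht'.le)
  have hw := period_window α β s T D hα hcomp hD t t' ht ht' he hlt
  obtain ⟨P, hP⟩ : ∃ P : ℕ, P = (dlt α β s t' - dlt α β s t).toNat := ⟨_, rfl⟩
  rw [← hP] at hw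
  refine ⟨P, by omega, by omega, ?_⟩
  obtain ⟨L, R, hLR, hL, hR⟩ := hblock (s t)
  have hlen : (α (s t)).length = L.length + pos κ s T + R.length := by
    rw [hLR]; simp [pos]; omega
  -- copy of the prefix inside the block
  have hcopy : ∀ z < pos κ s T, s (pos α s t + (L.length + z)) = s z := by
    intro z hz
    have h1 := hα.blk (t := t) (z := L.length + z) (by omega)
    rw [hLR, List.append_assoc, List.getElem?_append_right (by omega),
      List.getElem?_append_left (by change _ < pos κ s T; omega), hκ T] at h1
    have h2 : L.length + z - L.length = z := by omega
    rw [h2, pre_getElem? _ _ _ hz] at h1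
    simpa using h1.symm
  have hper : ∀ z, z + P < pos κ s T → s (z + P) = s z := by
    intro z hz
    rw [← hcopy z (by omega), ← hcopy (z + P) hz, hw (L.length + z) (by omega) (by omega)]
    congr 1; omega
  intro y
  obtain ⟨r, z, rfl, hz⟩ := exists_pos κ s hκ1 y
  obtain ⟨r0, h0, e0, e1⟩ := hpair r
  have hk := hκD (s (r + 1))
  have b1 := hκ.eq_of₂ e0.symm e1.symm (z := z) (by omega)
  have b2 := hκ.eq_of₂ e0.symm e1.symm (z := z + P) (by omega)
  rw [b1, add_assoc, b2, ← add_assoc]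
  apply hper
  have m := pos_mono κ s (show r0 + 1 + 1 ≤ T from h0)
  rw [pos_succ, pos_succ, e0, e1] at m
  omega

lemma sync (α β κ : X → List X) (s : ℕ → X) (T D : ℕ) (hα : FixW α s) (hκ : FixW κ s)
    (hpair : ∀ t, ∃ t0, t0 + 1 < T ∧ s t0 = s t ∧ s (t0 + 1) = s (t + 1))
    (hcomp : ∀ t < T, ∀ z < (β (s t)).length, pos β s t + z < pos α s T →
      (β (s t))[z]? = some (s (pos β s t + z)))
    (hD : ∀ t ≤ T, |dlt α β s t| ≤ D)
    (hκ1 : ∀ b, 1 ≤ (κ b).length) (hκD : ∀ b, 3 * D ≤ (κ b).length)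
    (hblock : ∀ a, ∃ L R, α a = L ++ applyM κ (pre s T) ++ R ∧
      3 * D ≤ L.length ∧ 3 * D ≤ R.length) :
    (∀ t, ∀ t0 < T, s t0 = s t → dlt α β s t = dlt α β s t0) ∨
      (∃ P, 0 < P ∧ P ≤ 2 * D ∧ ∀ y, s (y + P) = s y) := by
  by_cases hc : ∀ t < T, ∀ t' < T, s t = s t' → dlt α β s t = dlt α β s t'
  · exact Or.inl (consistent_extend α β s T hpair hc)
  · right
    push Not at hc
    obtain ⟨t, ht, t', ht', he, hne⟩ := hc
    rcases lt_or_gt_of_ne hne with h | h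
    · exact sync_aux α β κ s T D hα hκ hpair hcomp hD hκ1 hκD hblock t t' ht ht' he h
    · exact sync_aux α β κ s T D hα hκ hpair hcomp hD hκ1 hκD hblock t' t ht' ht he.symm h

/-- Consistency implies that `β` fixes `s`. -/
lemma fix_of_consistent (α β : X → List X) (s : ℕ → X) (T D : ℕ) (hα : FixW α s)
    (hpair : ∀ t, ∃ t0, t0 + 1 < T ∧ s t0 = s t ∧ s (t0 + 1) = s (t + 1))
    (hcomp : ∀ t < T, ∀ z < (β (s t)).length, pos β s t + z < pos α s T →
      (β (s t))[z]? = some (s (pos β s t + z)))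
    (hD : ∀ t ≤ T, |dlt α β s t| ≤ D) (hαD : ∀ b, D + 1 ≤ (α b).length)
    (hc : ∀ t, ∀ t0 < T, s t0 = s t → dlt α β s t = dlt α β s t0) : FixW β s := by
  apply fix_of_blk
  intro t q hq
  have d1 : dlt α β s t = (pos α s t : ℤ) - pos β s t := rfl
  by_cases hcase : dlt α β s t ≤ q
  · obtain ⟨t0, h0, e0, e1⟩ := hpair t
    have k0 := hc t t0 (by omega) e0
    have k1 := hc (t + 1) (t0 + 1) h0 e1
    have a1 := abs_le.1 (hD (t0 + 1) h0.le)
    have s1 := dlt_succ α β s t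
    have d0 : dlt α β s t0 = (pos α s t0 : ℤ) - pos β s t0 := rfl
    obtain ⟨z, hz⟩ : ∃ z : ℕ, (z : ℤ) = q - dlt α β s t := ⟨(q - dlt α β s t).toNat, by omega⟩
    have hb := hαD (s (t + 1))
    have hzl : z < (α (s t)).length + (α (s (t + 1))).length := by omega
    have b1 := hα.eq_of₂ e0.symm e1.symm hzl
    have m := pos_mono α s (show t0 + 1 + 1 ≤ T from h0)
    rw [pos_succ, pos_succ, e0, e1] at m
    have c := hcomp t0 (by omega) q (by rw [e0]; exact hq) (by omega)
    have g1 : pos β s t + q = pos α s t + z := by omega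
    have g2 : pos β s t0 + q = pos α s t0 + z := by omega
    rw [← e0, c, g1, g2, b1]
  · cases t with
    | zero => simp [dlt, pos_zero] at hcase
    | succ t =>
      obtain ⟨t0, h0, e0, e1⟩ := hpair t
      have k1 := hc (t + 1) (t0 + 1) h0 e1
      have a1 := abs_le.1 (hD (t0 + 1) h0.le)
      have d0 : dlt α β s (t0 + 1) = (pos α s (t0 + 1) : ℤ) - pos β s (t0 + 1) := rfl
      have hb := hαD (s t)
      have p1 := pos_succ α s t
      have p0 := pos_succ α s t0
      have e0' : (α (s t)).length = (α (s t0)).length := by rw [e0]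
      obtain ⟨z, hz⟩ : ∃ z : ℕ, (z : ℤ) = (α (s t)).length - (dlt α β s (t + 1) - q) :=
        ⟨((α (s t)).length - (dlt α β s (t + 1) - q)).toNat, by omega⟩
      have b1 := hα.eq_of e0.symm (z := z) (by omega)
      have m := pos_mono α s h0.le
      have c := hcomp (t0 + 1) h0 q (by rw [e1]; exact hq) (by omega)
      have g1 : pos β s (t + 1) + q = pos α s t + z := by omega
      have g2 : pos β s (t0 + 1) + q = pos α s t0 + z := by omega
      rw [← e1, c, g1, g2, b1]

lemma periodic_mod (s : ℕ → X) (P : ℕ) (hP : ∀ y, s (y + P) = s y) (k y : ℕ) :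
    s (y + k * P) = s y := by
  induction k with
  | zero => simp
  | succ k ih => rw [Nat.succ_mul, ← add_assoc, hP, ih]

lemma pos_periodic (β : X → List X) (s : ℕ → X) (P : ℕ) (hP : ∀ y, s (y + P) = s y) (t : ℕ) :
    pos β s (t + P) = pos β s t + pos β s P := by
  induction t with
  | zero => simp [pos_zero]
  | succ t ih =>
    rw [show t + 1 + P = t + P + 1 by omega, pos_succ, ih, hP, pos_succ]; omega

lemma pos_periodic_mul (β : X → List X) (s : ℕ → X) (P : ℕ) (hP : ∀ y, s (y + P) = s y)
    (k t : ℕ) : pos β s (t + k * P) = pos β s t + k * pos β s P := by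
  induction k with
  | zero => simp
  | succ k ih =>
    rw [Nat.succ_mul, ← add_assoc, pos_periodic β s P hP, ih, Nat.succ_mul]; omega

/-- In the periodic case comparability on a long prefix implies fixing. -/
lemma fix_of_periodic (β : X → List X) (s : ℕ → X) (P : ℕ) (hP0 : 0 < P)
    (hP : ∀ y, s (y + P) = s y) (hβ : ∀ a, 1 ≤ (β a).length)
    (hcomp : ∀ t < 2 * P, ∀ z < (β (s t)).length, 
      (β (s t))[z]? = some (s (pos β s t + z))) : FixW β s := by
  have hQP := pos_ge β s hβ P
  obtain ⟨Q, hQ⟩ : ∃ Q, Q = pos β s P := ⟨_, rfl⟩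
  have h1 : ∀ y < Q, s (y + Q) = s y := by
    intro y hy
    obtain ⟨t, z, rfl, hz⟩ := exists_pos β s hβ y
    have ht : t < P := by
      by_contra hh
      have := pos_mono β s (not_lt.1 hh)
      omega
    have c1 := hcomp t (by omega) z hz
    have c2 := hcomp (t + P) (by omega) z (by rw [hP]; exact hz)
    rw [hP, c1, pos_periodic β s P hP, ← hQ] at c2
    have c3 : s (pos β s t + z) = s (pos β s t + Q + z) := by simpa using c2
    rw [c3]; congr 1; omega
  have h2 : ∀ y, s (y + Q) = s y := by
    intro y
    have e := Nat.mod_add_div y P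
    have hm := Nat.mod_lt y hP0
    have e1 := periodic_mod s P hP (y / P) (y % P)
    have e2 := periodic_mod s P hP (y / P) (y % P + Q)
    have e3 : y % P + y / P * P = y := by rw [Nat.mul_comm]; exact e
    have e4 : y % P + Q + y / P * P = y + Q := by omega
    rw [e3] at e1
    rw [e4] at e2
    rw [e1, e2]
    exact h1 _ (by omega)
  apply fix_of_blk
  intro t z hz
  have hm := Nat.mod_lt t hP0
  have e3 : t % P + t / P * P = t := by rw [Nat.mul_comm]; exact Nat.mod_add_div t P
  have e1 := periodic_mod s P hP (t / P) (t % P)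
  have e2 := pos_periodic_mul β s P hP (t / P) (t % P)
  rw [e3] at e1 e2
  rw [e1] at hz ⊢
  rw [hcomp (t % P) (by omega) z hz, e2, ← hQ]
  have := periodic_mod s Q h2 (t / P) (pos β s (t % P) + z)
  rw [← this]; congr 2; omega

/-! ### Chains of sets, primitive morphisms -/

lemma chain_stab {Y : Type*} [Fintype Y] (S : ℕ → Finset Y) (hm : ∀ k, S k ⊆ S (k + 1))
    (hst : ∀ k, S k = S (k + 1) → S (k + 1) = S (k + 2)) (N : ℕ)
    (hN : Fintype.card Y ≤ N + (S 0).card) : ∀ k, N ≤ k → S k = S N := by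
  have key : ∃ k ≤ N, S k = S (k + 1) := by
    by_contra hcon
    push Not at hcon
    have h1 : ∀ k, k ≤ N + 1 → (S 0).card + k ≤ (S k).card := by
      intro k hk
      induction k with
      | zero => simp
      | succ k ih =>
        have h2 := Finset.card_lt_card ((hm k).ssubset_of_ne (hcon k (by omega)))
        have := ih (by omega)
        omega
    have h3 := h1 (N + 1) le_rfl
    have h4 := Finset.card_le_univ (S (N + 1))
    omega
  obtain ⟨k0, hk0, he⟩ := key
  have h5 : ∀ l, S (k0 + l) = S (k0 + l + 1) := by
    intro l
    induction l with
    | zero => exact he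
    | succ l ih => exact hst _ ih
  have h6 : ∀ l, S (k0 + l) = S k0 := by
    intro l
    induction l with
    | zero => rfl
    | succ l ih => rw [← ih, h5 l]; rfl
  intro k hk
  obtain ⟨a, rfl⟩ := Nat.exists_eq_add_of_le hk0
  obtain ⟨b, rfl⟩ := Nat.exists_eq_add_of_le hk
  rw [h6, add_assoc, h6]

/-- Every image contains every letter. -/
def FullM (f : X → List X) : Prop := ∀ a b : X, b ∈ f a

lemma FullM.pos {f : X → List X} (h : FullM f) (a : X) : 1 ≤ (f a).length :=
  List.length_pos_of_mem (h a a)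

lemma mem_iterM_add (g : X → List X) (k l : ℕ) (a b c : X) (h1 : b ∈ iterM g l [a])
    (h2 : c ∈ iterM g k [b]) : c ∈ iterM g (k + l) [a] := by
  rw [iterM_add, ← applyM_powM, mem_applyM]
  exact ⟨b, h1, h2⟩

lemma full_of_primitive [Fintype X] (g : X → List X) (hg : Primitive g) (x : X)
    (hx : [x] <+: g x) (n : ℕ) (hn : n = Fintype.card X) (hn1 : 1 ≤ n) :
    FullM (powM g (2 * n - 2)) := by
  classical
  obtain ⟨k0, hk0, hp⟩ := hg
  have hxx : x ∈ g x := hx.subset (by simp)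
  have hxx1 : x ∈ iterM g 1 [x] := by
    rw [iterM_succ, iterM_zero, applyM_single]; exact hxx
  have hxk : ∀ k, x ∈ iterM g k [x] := by
    intro k
    induction k with
    | zero => simp [iterM_zero]
    | succ k ih => exact mem_iterM_add g k 1 x x x hxx1 ih
  have hall : ∀ a b l, b ∈ iterM g (k0 + l * k0) [a] := by
    intro a b l
    induction l generalizing b with
    | zero => simpa using hp b a
    | succ l ih =>
      have := mem_iterM_add g k0 _ a a b (ih a) (hp b a)
      rwa [show k0 + (l + 1) * k0 = k0 + (k0 + l * k0) by ring]
  -- letters reachable from `x`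
  have h1 : ∀ b, b ∈ iterM g (n - 1) [x] := by
    let S : ℕ → Finset X := fun k => Finset.univ.filter fun b => b ∈ iterM g k [x]
    have hS : ∀ k b, b ∈ S k ↔ b ∈ iterM g k [x] := by intro k b; simp [S]
    have hst := chain_stab S
      (by
        intro k b hb
        rw [hS] at hb ⊢
        exact mem_iterM_add g k 1 x x b hxx1 hb)
      (by
        intro k he
        ext b
        rw [hS, hS, iterM_succ, mem_applyM, iterM_succ g (k+1), mem_applyM]
        simp only [← hS, he]) (n - 1)
      (by
        have : 1 ≤ (S 0).card := Finset.card_pos.2 ⟨x, by rw [hS]; simp [iterM_zero]⟩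
        omega)
    intro b
    have h2 := hall x b n
    rw [← hS, hst _ (by have := Nat.le_mul_of_pos_right n hk0; omega)] at h2
    rwa [← hS]
  have h2 : ∀ a, x ∈ iterM g (n - 1) [a] := by
    let S : ℕ → Finset X := fun k => Finset.univ.filter fun a => x ∈ iterM g k [a]
    have hS : ∀ k a, a ∈ S k ↔ x ∈ iterM g k [a] := by intro k b; simp [S]
    have hstep : ∀ k a, x ∈ iterM g (k + 1) [a] ↔ ∃ b ∈ g a, b ∈ S k := by
      intro k a
      rw [iterM_succ', ← applyM_powM, mem_applyM, applyM_single]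
      simp only [hS]; rfl
    have hst := chain_stab S
      (by
        intro k b hb
        rw [hS] at hb ⊢
        have := mem_iterM_add g 1 k b x x hb hxx1
        rwa [add_comm] at this)
      (by
        intro k he
        ext b
        rw [hS, hS, hstep, hstep, he]) (n - 1)
      (by
        have : 1 ≤ (S 0).card := Finset.card_pos.2 ⟨x, by rw [hS]; simp [iterM_zero]⟩
        omega)
    intro b
    have h2 := hall b x n
    rw [← hS, hst _ (by have := Nat.le_mul_of_pos_right n hk0; omega)] at h2
    rwa [← hS]
  intro a b
  have := mem_iterM_add g (n - 1) (n - 1) a x b (h2 a) (h1 b)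
  rw [show 2 * n - 2 = n - 1 + (n - 1) by omega]
  exact this

/-! ### Growth -/

lemma length_le_Mg [Fintype X] (f : X → List X) (a : X) : (f a).length ≤ Mg f :=
  Finset.le_sup (f := fun x => (f x).length) (Finset.mem_univ a)

lemma exists_Mg [Fintype X] [Nonempty X] (f : X → List X) : ∃ a, (f a).length = Mg f := by
  obtain ⟨a, -, ha⟩ := Finset.exists_mem_eq_sup Finset.univ Finset.univ_nonempty
    (fun x => (f x).length)
  exact ⟨a, ha.symm⟩

lemma applyM_length_le (f : X → List X) (M : ℕ) (h : ∀ a, (f a).length ≤ M) (w : List X) :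
    (applyM f w).length ≤ M * w.length := by
  induction w with
  | nil => simp [applyM]
  | cons a w ih =>
    rw [applyM_cons, List.length_append, List.length_cons]
    have := h a; nlinarith

lemma applyM_length_ge' (f : X → List X) (M : ℕ) (h : ∀ a, M ≤ (f a).length) (w : List X) :
    M * w.length ≤ (applyM f w).length := by
  induction w with
  | nil => simp [applyM]
  | cons a w ih =>
    rw [applyM_cons, List.length_append, List.length_cons]
    have := h a; nlinarith

lemma iterM_length_le (f : X → List X) (M : ℕ) (h : ∀ a, (f a).length ≤ M) (k : ℕ)
    (w : List X) : (iterM f k w).length ≤ M ^ k * w.length := by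
  induction k with
  | zero => simp [iterM_zero]
  | succ k ih =>
    rw [iterM_succ]
    calc _ ≤ M * (iterM f k w).length := applyM_length_le f M h _
      _ ≤ M * (M ^ k * w.length) := Nat.mul_le_mul_left _ ih
      _ = _ := by ring

lemma two_step [Fintype X] [Nonempty X] (f : X → List X) (hf : FullM f) (a : X) :
    Mg f ≤ (iterM f 2 [a]).length := by
  obtain ⟨b, hb⟩ := exists_Mg f
  rw [iterM_succ, iterM_succ, iterM_zero, applyM_single, ← hb]
  exact length_le_of_mem f (hf a b)

lemma growth [Fintype X] [Nonempty X] (f : X → List X) (hf : FullM f) (k : ℕ) (a : X) :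
    Mg f ^ k ≤ (iterM f (2 * k) [a]).length := by
  induction k with
  | zero => simp [iterM_zero]
  | succ k ih =>
    have h1 := applyM_length_ge' (powM f 2) (Mg f) (two_step f hf) (iterM f (2 * k) [a])
    rw [applyM_powM, ← iterM_add] at h1
    rw [show 2 * (k + 1) = 2 + 2 * k by ring, pow_succ]
    nlinarith

/-! ### Pairs of letters -/

lemma pairs_aux [Fintype X] (f : X → List X) (hf : FullM f) (s : ℕ → X) (hs : FixW f s)
    (hgr : ∀ N, ∃ k, N ≤ pos (powM f k) s 1) :
    ∀ t, ∃ t0, t0 + 1 < pos (powM f (Fintype.card X ^ 2 + 1)) s 1 ∧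
      s t0 = s t ∧ s (t0 + 1) = s (t + 1) := by
  classical
  have hW : ∀ k, pos (powM f (k + 1)) s 1 = pos f s (pos (powM f k) s 1) := by
    intro k; rw [powM_succ, pos_compM (hs.pow k)]
  have hmono : ∀ k, pos (powM f k) s 1 ≤ pos (powM f (k + 1)) s 1 := by
    intro k; rw [hW]; exact pos_ge f s hf.pos _
  have hlet : ∀ k a, ∃ r < pos (powM f (k + 1)) s 1, s r = a := by
    intro k a
    have h1 : pos (powM f 1) s 1 ≤ pos (powM f (k + 1)) s 1 :=
      monotone_nat_of_le_succ (f := fun k => pos (powM f k) s 1) hmono (by omega)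
    have h2 : pos (powM f 1) s 1 = pos f s 1 := by
      rw [hW]; rfl
    have h3 : a ∈ f (s 0) := hf _ _
    obtain ⟨r, hr, he⟩ := List.getElem_of_mem h3
    have h4 := hs.blk (t := 0) (z := r) hr
    rw [List.getElem?_eq_getElem hr, he, pos_zero, Nat.zero_add] at h4
    refine ⟨r, ?_, by simpa using h4.symm⟩
    rw [h2, pos_one] at h1; omega
  let S : ℕ → Finset (X × X) := fun k => Finset.univ.filter fun p =>
    ∃ t, t + 1 < pos (powM f (k + 1)) s 1 ∧ s t = p.1 ∧ s (t + 1) = p.2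
  have hS : ∀ k p, p ∈ S k ↔ ∃ t, t + 1 < pos (powM f (k + 1)) s 1 ∧ s t = p.1 ∧ s (t + 1) = p.2 := by
    intro k p; simp [S]
  have hsub : ∀ k, S k ⊆ S (k + 1) := by
    intro k p hp
    rw [hS] at hp ⊢
    obtain ⟨t, ht, h⟩ := hp
    exact ⟨t, ht.trans_le (hmono _), h⟩
  have hst := chain_stab S hsub
    (by
      intro k he
      apply Finset.Subset.antisymm (hsub _)
      intro p hp
      rw [hS] at hp ⊢
      obtain ⟨t, ht, h1, h2⟩ := hp
      obtain ⟨r, z, rfl, hz⟩ := exists_pos f s hf.pos t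
      rw [hW] at ht
      have hr : r < pos (powM f (k + 2)) s 1 := by
        by_contra hh
        have := pos_mono f s (not_lt.1 hh)
        simp only [Nat.add_assoc] at *
        omega
      by_cases hz1 : z + 1 < (f (s r)).length
      · obtain ⟨r', hr', e⟩ := hlet k (s r)
        refine ⟨pos f s r' + z, ?_, ?_, ?_⟩
        · have m := pos_mono f s (show r' + 1 ≤ _ from hr')
          rw [pos_succ, e, ← hW] at m
          omega
        · rw [← h1]; exact hs.eq_of e (by rw [e]; exact hz)
        · rw [← h2, add_assoc, add_assoc]; exact hs.eq_of e (by rw [e]; exact hz1)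
      · have hr2 : r + 1 < pos (powM f (k + 2)) s 1 := by
          by_contra hh
          have := pos_mono f s (not_lt.1 hh)
          rw [pos_succ f] at this
          simp only [Nat.add_assoc] at *
          omega
        have hp2 : (s r, s (r + 1)) ∈ S (k + 1) := by
          rw [hS]; exact ⟨r, hr2, rfl, rfl⟩
        rw [← he, hS] at hp2
        obtain ⟨r', hr', e, e'⟩ := hp2
        simp only at e e'
        have hf1 := hf.pos (s (r + 1))
        refine ⟨pos f s r' + z, ?_, ?_, ?_⟩
        · have m := pos_mono f s (show r' + 1 + 1 ≤ _ from hr')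
          rw [pos_succ, pos_succ, e, e', ← hW] at m
          omega
        · rw [← h1]; exact hs.eq_of e (by rw [e]; exact hz)
        · rw [← h2, add_assoc, add_assoc]; exact hs.eq_of₂ e e' (by rw [e, e']; omega))
    (Fintype.card X ^ 2) (by rw [Fintype.card_prod]; nlinarith)
  intro t
  obtain ⟨k, hk⟩ := hgr (t + 2)
  have h1 : (s t, s (t + 1)) ∈ S (k + Fintype.card X ^ 2) := by
    rw [hS]
    refine ⟨t, ?_, rfl, rfl⟩
    have : pos (powM f k) s 1 ≤ pos (powM f (k + Fintype.card X ^ 2 + 1)) s 1 :=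
      monotone_nat_of_le_succ (f := fun k => pos (powM f k) s 1) hmono (by omega)
    omega
  rw [hst _ (by omega), hS] at h1
  exact h1

/-! ### Bounded orbits of linear maps -/

lemma orbit_step {E : Type*} [NormedAddCommGroup E] [NormedSpace ℂ E] [FiniteDimensional ℂ E]
    (T : E →ₗ[ℂ] E) (v : E) (B : ℝ) (hB : ∀ k, ‖(T ^ k) v‖ ≤ B) (A : E →ₗ[ℂ] E) :
    ∃ B', ∀ k, ‖A ((T ^ k) v)‖ ≤ B' := by
  refine ⟨‖LinearMap.toContinuousLinearMap A‖ * B, fun k => ?_⟩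
  calc ‖A ((T ^ k) v)‖ = ‖LinearMap.toContinuousLinearMap A ((T ^ k) v)‖ := rfl
    _ ≤ ‖LinearMap.toContinuousLinearMap A‖ * ‖(T ^ k) v‖ := ContinuousLinearMap.le_opNorm _ _
    _ ≤ _ := mul_le_mul_of_nonneg_left (hB k) (norm_nonneg _)

open Polynomial in
lemma orbit_bound {E : Type*} [NormedAddCommGroup E] [NormedSpace ℂ E] [FiniteDimensional ℂ E]
    (T : E →ₗ[ℂ] E) (M : ℝ) (hM : 0 ≤ M) (hT : ∀ v, ‖T v‖ ≤ M * ‖v‖) (l : List ℂ) :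
    ∀ (v : E) (C : ℝ), ‖v‖ ≤ C → (∃ B, ∀ k, ‖(T ^ k) v‖ ≤ B) →
      aeval T ((l.map fun μ => (Polynomial.X - Polynomial.C μ)).prod) v = 0 →
      ∀ k : ℕ, ‖(T ^ k) v‖ ≤ C * ((1 + k) * (M + 1)) ^ l.length := by
  induction l with
  | nil =>
    intro v C hC _ h k
    simp at h
    subst h
    simp at hC ⊢
    exact hC
  | cons μ l ih =>
    intro v C hC hB h k
    obtain ⟨B, hB⟩ := hB
    have hC0 : 0 ≤ C := (norm_nonneg v).trans hC
    set p := (l.map fun μ => (Polynomial.X - Polynomial.C μ)).prod with hp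
    simp only [List.map_cons, List.prod_cons, List.length_cons] at h ⊢
    have hbase : (1 : ℝ) ≤ (1 + k) * (M + 1) := by
      have : (0 : ℝ) ≤ k := Nat.cast_nonneg k
      nlinarith
    by_cases hμ : ‖μ‖ ≤ 1
    · set y := T v - μ • v with hy
      have hpy : aeval T p y = 0 := by
        rw [mul_comm, map_mul, Module.End.mul_apply] at h
        simpa [hy] using h
      have hTy : ∀ k, (T ^ k) y = (T ^ (k + 1)) v - μ • (T ^ k) v := by
        intro k
        rw [hy, map_sub, map_smul, pow_succ, Module.End.mul_apply]
      have hyC : ‖y‖ ≤ C * (M + 1) := by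
        calc ‖y‖ ≤ ‖T v‖ + ‖μ • v‖ := norm_sub_le _ _
          _ ≤ M * ‖v‖ + 1 * ‖v‖ := by
            rw [norm_smul]
            exact add_le_add (hT v) (mul_le_mul_of_nonneg_right hμ (norm_nonneg _))
          _ ≤ C * (M + 1) := by nlinarith
      have hyB : ∃ B, ∀ k, ‖(T ^ k) y‖ ≤ B := by
        refine ⟨B + B, fun k => ?_⟩
        rw [hTy]
        calc _ ≤ ‖(T ^ (k + 1)) v‖ + ‖μ • (T ^ k) v‖ := norm_sub_le _ _
          _ ≤ B + B := by
            rw [norm_smul]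
            refine add_le_add (hB _) ?_
            calc _ ≤ 1 * ‖(T ^ k) v‖ := mul_le_mul_of_nonneg_right hμ (norm_nonneg _)
              _ ≤ B := by rw [one_mul]; exact hB k
      have hIH := ih y (C * (M + 1)) hyC hyB hpy
      have hsum : ∀ m : ℕ, m ≤ k →
          ‖(T ^ m) v‖ ≤ C + m * (C * (M + 1) * ((1 + k) * (M + 1)) ^ l.length) := by
        intro m hm
        induction m with
        | zero => simpa using hC
        | succ m ihm =>
          have h1 := ihm (by omega)
          have h2 := hIH m
          have h3 : (T ^ (m + 1)) v = (T ^ m) y + μ • (T ^ m) v := by rw [hTy]; abel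
          have h4 : C * (M + 1) * ((1 + (m : ℝ)) * (M + 1)) ^ l.length ≤
              C * (M + 1) * ((1 + k) * (M + 1)) ^ l.length := by
            have : (m : ℝ) ≤ k := by exact_mod_cast (by omega : m ≤ k)
            gcongr
          have h5 : ‖μ • (T ^ m) v‖ ≤ ‖(T ^ m) v‖ := by
            rw [norm_smul]
            calc _ ≤ 1 * ‖(T ^ m) v‖ := mul_le_mul_of_nonneg_right hμ (norm_nonneg _)
              _ = _ := one_mul _
          rw [h3]
          push_cast
          have := norm_add_le ((T ^ m) y) (μ • (T ^ m) v)
          nlinarith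
      have h1 := hsum k le_rfl
      set Q := ((1 + (k : ℝ)) * (M + 1)) ^ l.length with hQ
      have hQ1 : 1 ≤ Q := one_le_pow₀ hbase
      rw [pow_succ, ← hQ]
      have h6 : C ≤ C * ((M + 1) * Q) := by
        apply le_mul_of_one_le_right hC0
        nlinarith
      nlinarith
    · -- the eigenvalue is large, so it does not contribute
      have h0 : aeval T p v = 0 := by
        by_contra hne
        set y := aeval T p v with hy
        have hTy : T y = μ • y := by
          rw [map_mul, Module.End.mul_apply] at h
          simp only [map_sub, aeval_X, aeval_C, LinearMap.sub_apply, Module.algebraMap_end_apply] at h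
          exact sub_eq_zero.1 h
        have hTk : ∀ k, (T ^ k) y = μ ^ k • y := by
          intro k
          induction k with
          | zero => simp
          | succ k ihk =>
            rw [pow_succ', Module.End.mul_apply, ihk, map_smul, hTy, smul_smul, pow_succ]
        obtain ⟨B', hB'⟩ := orbit_step T v B hB (aeval T p)
        have hcomm : ∀ k, aeval T p ((T ^ k) v) = (T ^ k) y := by
          intro k
          have h1 : aeval T p * T ^ k = T ^ k * aeval T p := by
            have : T ^ k = aeval T (Polynomial.X ^ k : ℂ[X]) := by simp
            rw [this, ← map_mul, ← map_mul, mul_comm]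
          have := congrArg (fun A : E →ₗ[ℂ] E => A v) h1
          simpa using this
        have hμ1 : 1 < ‖μ‖ := not_le.1 hμ
        obtain ⟨k, hk⟩ := pow_unbounded_of_one_lt (B' / ‖y‖) hμ1
        have hy0 : 0 < ‖y‖ := norm_pos_iff.2 hne
        have h2 := hB' k
        rw [hcomm, hTk, norm_smul, norm_pow] at h2
        rw [div_lt_iff₀ hy0] at hk
        linarith
      have h1 := ih v C hC ⟨B, hB⟩ h0 k
      refine h1.trans ?_
      apply mul_le_mul_of_nonneg_left _ hC0
      exact pow_le_pow_right₀ hbase (by omega)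

lemma sum_map_norm_le (v : X → ℂ) (C : ℝ) (h : ∀ a, ‖v a‖ ≤ C) (w : List X) :
    ‖(w.map v).sum‖ ≤ w.length * C := by
  induction w with
  | nil => simp
  | cons a w ih =>
    simp only [List.map_cons, List.sum_cons, List.length_cons]
    have := norm_add_le (v a) (w.map v).sum
    have := h a
    push_cast
    linarith

def opT (f : X → List X) : (X → ℂ) →ₗ[ℂ] (X → ℂ) where
  toFun v := fun a => ((f a).map v).sum
  map_add' u v := by
    funext a
    simp only [Pi.add_apply]
    induction f a with
    | nil => simp
    | cons b w ih => simp only [List.map_cons, List.sum_cons, ih, Pi.add_apply]; ring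
  map_smul' c v := by
    funext a
    simp only [RingHom.id_apply, Pi.smul_apply]
    induction f a with
    | nil => simp
    | cons b w ih => simp only [List.map_cons, List.sum_cons, ih, Pi.smul_apply, smul_eq_mul]; ring

lemma opT_sum (f : X → List X) (v : X → ℂ) (w : List X) :
    (w.map (opT f v)).sum = ((applyM f w).map v).sum := by
  induction w with
  | nil => simp [applyM]
  | cons a w ih => rw [applyM_cons]; simp [ih]; rfl

lemma opT_pow (f : X → List X) (v : X → ℂ) (k : ℕ) (a : X) :
    ((opT f) ^ k) v a = ((iterM f k [a]).map v).sum := by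
  induction k generalizing v with
  | zero => simp [iterM_zero]
  | succ k ih =>
    rw [pow_succ, Module.End.mul_apply, ih, opT_sum, iterM_succ]

lemma balance_bound [Fintype X] (f : X → List X) (v : X → ℂ) (C B : ℝ)
    (hC0 : 0 ≤ C) (hC : ∀ a, ‖v a‖ ≤ C)
    (hB : ∀ k a, ‖((iterM f k [a]).map v).sum‖ ≤ B) (k : ℕ) (a : X) :
    ‖((iterM f k [a]).map v).sum‖ ≤ C * ((1 + k) * (Mg f + 1)) ^ (Fintype.card X) := by
  classical
  have hT : ∀ v, ‖opT f v‖ ≤ (Mg f : ℝ) * ‖v‖ := by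
    intro v
    rw [pi_norm_le_iff_of_nonneg (by positivity)]
    intro a
    calc ‖opT f v a‖ ≤ (f a).length * ‖v‖ := sum_map_norm_le v _ (fun a => norm_le_pi_norm v a) _
      _ ≤ _ := by
        apply mul_le_mul_of_nonneg_right _ (norm_nonneg _)
        exact_mod_cast length_le_Mg f a
  have hB0 : 0 ≤ B := (norm_nonneg _).trans (hB 0 a)
  set q := (opT f).charpoly with hq
  have hsplit : q.Splits := IsAlgClosed.splits q
  have hprod := hsplit.eq_prod_roots_of_monic (LinearMap.charpoly_monic _)
  have hcard : q.roots.card = Fintype.card X := by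
    rw [← hsplit.natDegree_eq_card_roots, hq, LinearMap.charpoly_natDegree]
    simp
  have hl : (q.roots.toList.map fun μ => (Polynomial.X - Polynomial.C μ)).prod = q := by
    conv_rhs => rw [hprod]
    conv_rhs => rw [← Multiset.coe_toList q.roots]
    rw [Multiset.map_coe, Multiset.prod_coe]
  have hlen : q.roots.toList.length = Fintype.card X := by simp [hcard]
  have := orbit_bound (opT f) (Mg f) (by positivity) hT q.roots.toList v C
    ((pi_norm_le_iff_of_nonneg hC0).2 hC)
    ⟨B, fun k => (pi_norm_le_iff_of_nonneg hB0).2 fun a => by rw [opT_pow]; exact hB k a⟩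
    (by rw [hl, hq, LinearMap.aeval_self_charpoly]; rfl) k
  rw [hlen] at this
  rw [← opT_pow]
  exact (norm_le_pi_norm _ a).trans this

/-! ### Frequencies -/

lemma iter_cmp (f : X → List X) (hf : FullM f) (k : ℕ) (w : List X) (b : X) :
    (iterM f k w).length ≤ (iterM f (k + 1) [b]).length * w.length := by
  rw [← applyM_powM]
  apply applyM_length_le
  intro a
  rw [iterM_succ', applyM_single, ← applyM_powM]
  exact length_le_of_mem _ (hf b a)

lemma theta_bound [Fintype X] (f : X → List X) (hf : FullM f) (k : ℕ) (a b : X) :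
    (iterM f (k + 1) [a]).length ≤ (Mg f) ^ 2 * (iterM f k [b]).length := by
  have hM : 1 ≤ Mg f := (hf.pos a).trans (length_le_Mg f a)
  cases k with
  | zero =>
    rw [iterM_succ, iterM_zero, iterM_zero, applyM_single]
    have := length_le_Mg f a
    simp; nlinarith
  | succ k =>
    rw [show k + 1 + 1 = k + 2 by ring, iterM_add]
    have h1 := iter_cmp f hf k (iterM f 2 [a]) b
    have h2 := iterM_length_le f (Mg f) (length_le_Mg f) 2 [a]
    simp only [List.length_singleton, mul_one] at h2
    calc _ ≤ _ := h1
      _ ≤ (iterM f (k + 1) [b]).length * Mg f ^ 2 := Nat.mul_le_mul_left _ h2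
      _ = _ := mul_comm _ _

def asum (ψ : X → ℝ) (w : List X) : ℝ := (w.map ψ).sum

lemma asum_append (ψ : X → ℝ) (u v : List X) : asum ψ (u ++ v) = asum ψ u + asum ψ v := by
  simp [asum]

lemma asum_cons (ψ : X → ℝ) (a : X) (v : List X) : asum ψ (a :: v) = ψ a + asum ψ v := by
  simp [asum]

lemma asum_sub (ψ : X → ℝ) (L : ℝ) (w : List X) :
    asum (fun a => ψ a - L) w = asum ψ w - L * w.length := by
  induction w with
  | nil => simp [asum]
  | cons a w ih => rw [asum_cons, asum_cons, ih]; push_cast [List.length_cons]; ring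

lemma lower_word (ψ : X → ℝ) (κ : X → List X) (V : ℝ)
    (h : ∀ a, V * (κ a).length ≤ asum ψ (κ a)) (w : List X) :
    V * (applyM κ w).length ≤ asum ψ (applyM κ w) := by
  induction w with
  | nil => simp [applyM, asum]
  | cons a w ih =>
    rw [applyM_cons, asum_append]; have := h a; push_cast [List.length_append]; nlinarith

lemma upper_word (ψ : X → ℝ) (κ : X → List X) (U : ℝ)
    (h : ∀ a, asum ψ (κ a) ≤ U * (κ a).length) (w : List X) :
    asum ψ (applyM κ w) ≤ U * (applyM κ w).length := by
  induction w with
  | nil => simp [applyM, asum]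
  | cons a w ih =>
    rw [applyM_cons, asum_append]; have := h a; push_cast [List.length_append]; nlinarith

lemma lower_word' (ψ : X → ℝ) (f : X → List X) (k : ℕ) (V : ℝ)
    (h : ∀ a, V * (iterM f k [a]).length ≤ asum ψ (iterM f k [a])) (w : List X) :
    V * (iterM f k w).length ≤ asum ψ (iterM f k w) := by
  rw [← applyM_powM]; exact lower_word ψ (powM f k) V h w

lemma upper_word' (ψ : X → ℝ) (f : X → List X) (k : ℕ) (V : ℝ)
    (h : ∀ a, asum ψ (iterM f k [a]) ≤ V * (iterM f k [a]).length) (w : List X) :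
    asum ψ (iterM f k w) ≤ V * (iterM f k w).length := by
  rw [← applyM_powM]; exact upper_word ψ (powM f k) V h w

lemma contraction (f : X → List X) (hf : FullM f) (x : X) (ψ : X → ℝ) (k : ℕ) (θ V U : ℝ)
    (hθ0 : 0 ≤ θ) (hθ : ∀ a, θ * (iterM f (k + 1) [a]).length ≤ (iterM f k [x]).length)
    (hVU : V ≤ U)
    (hV : ∀ a, V * (iterM f k [a]).length ≤ asum ψ (iterM f k [a]))
    (hU : ∀ a, asum ψ (iterM f k [a]) ≤ U * (iterM f k [a]).length) :
    ∃ V' U', V' ≤ U' + (θ * 0) ∧ U' - V' = (1 - θ / 2) * (U - V) ∧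
    (∀ a, V' * (iterM f (k + 1) [a]).length ≤ asum ψ (iterM f (k + 1) [a])) ∧
    (∀ a, asum ψ (iterM f (k + 1) [a]) ≤ U' * (iterM f (k + 1) [a]).length) := by
  have hθ1 : θ ≤ 1 := by
    have h1 := hθ x
    have h2 : (iterM f k [x]).length ≤ (iterM f (k + 1) [x]).length := by
      rw [iterM_succ]; exact applyM_length_ge f hf.pos _
    have h3 : 1 ≤ (iterM f k [x]).length := by
      simpa using iterM_length_ge f hf.pos k [x]
    have h2' : ((iterM f k [x]).length : ℝ) ≤ (iterM f (k + 1) [x]).length := by exact_mod_cast h2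
    have h3' : (1 : ℝ) ≤ (iterM f k [x]).length := by exact_mod_cast h3
    by_contra hh
    nlinarith
  have hdec : ∀ a, ∃ p q, iterM f (k + 1) [a] = iterM f k p ++ (iterM f k [x] ++ iterM f k q) := by
    intro a
    obtain ⟨p, q, h⟩ := List.append_of_mem (hf a x)
    refine ⟨p, q, ?_⟩
    rw [iterM_succ', applyM_single, h, ← iterM_append, ← iterM_append]; rfl
  by_cases hc : (U + V) / 2 * (iterM f k [x]).length ≤ asum ψ (iterM f k [x])
  · refine ⟨V + θ * (U - V) / 2, U, by nlinarith, by ring, ?_, ?_⟩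
    · intro a
      have ha := hθ a
      obtain ⟨p, q, h⟩ := hdec a
      have e1 := lower_word' ψ f k V hV p
      have e2 := lower_word' ψ f k V hV q
      have hl : ((iterM f (k + 1) [a]).length : ℝ) =
        (iterM f k p).length + ((iterM f k [x]).length + (iterM f k q).length) := by
        rw [h]; push_cast [List.length_append]; ring
      have hs : asum ψ (iterM f (k + 1) [a]) = asum ψ (iterM f k p) +
        (asum ψ (iterM f k [x]) + asum ψ (iterM f k q)) := by
        rw [h, asum_append, asum_append]
      have := mul_le_mul_of_nonneg_left ha (by linarith : 0 ≤ (U - V) / 2)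
      rw [hs]
      have e3 : (V + θ * (U - V) / 2) * (iterM f (k + 1) [a]).length =
        V * (iterM f (k + 1) [a]).length + (U - V) / 2 * (θ * (iterM f (k + 1) [a]).length) := by
        ring
      rw [e3]
      rw [show V * ((iterM f (k + 1) [a]).length : ℝ) = V * ((iterM f k p).length +
        ((iterM f k [x]).length + (iterM f k q).length)) by rw [hl]]
      nlinarith
    · intro a
      rw [iterM_succ']
      exact upper_word' ψ f k U hU _
  · refine ⟨V, U - θ * (U - V) / 2, by nlinarith, by ring, ?_, ?_⟩
    · intro a
      rw [iterM_succ']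
      exact lower_word' ψ f k V hV _
    · intro a
      have ha := hθ a
      obtain ⟨p, q, h⟩ := hdec a
      have e1 := upper_word' ψ f k U hU p
      have e2 := upper_word' ψ f k U hU q
      have hl : ((iterM f (k + 1) [a]).length : ℝ) =
        (iterM f k p).length + ((iterM f k [x]).length + (iterM f k q).length) := by
        rw [h]; push_cast [List.length_append]; ring
      have hs : asum ψ (iterM f (k + 1) [a]) = asum ψ (iterM f k p) +
        (asum ψ (iterM f k [x]) + asum ψ (iterM f k q)) := by
        rw [h, asum_append, asum_append]
      have := mul_le_mul_of_nonneg_left ha (by linarith : 0 ≤ (U - V) / 2)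
      rw [hs]
      have e3 : (U - θ * (U - V) / 2) * (iterM f (k + 1) [a]).length =
        U * (iterM f (k + 1) [a]).length - (U - V) / 2 * (θ * (iterM f (k + 1) [a]).length) := by
        ring
      rw [e3]
      rw [show U * ((iterM f (k + 1) [a]).length : ℝ) = U * ((iterM f k p).length +
        ((iterM f k [x]).length + (iterM f k q).length)) by rw [hl]]
      push Not at hc
      nlinarith

lemma freq_level [Fintype X] (f : X → List X) (hf : FullM f) (x : X) (ψ : X → ℝ) :
    ∃ L : ℝ, ∀ ε > 0, ∃ k, ∀ w,
      |asum (fun a => ψ a - L) (iterM f k w)| ≤ ε * (iterM f k w).length := by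
  obtain ⟨K, hK⟩ : ∃ K : ℝ, ∀ a, |ψ a| ≤ K :=
    ⟨∑ a, |ψ a|, fun a => Finset.single_le_sum (f := fun a => |ψ a|)
      (fun _ _ => abs_nonneg _) (Finset.mem_univ a)⟩
  have hK0 : 0 ≤ K := (abs_nonneg _).trans (hK x)
  have hM : (1 : ℝ) ≤ Mg f := by exact_mod_cast (hf.pos x).trans (length_le_Mg f x)
  set θ : ℝ := 1 / (Mg f : ℝ) ^ 2 with hθ
  have hM2 : (1 : ℝ) ≤ (Mg f : ℝ) ^ 2 := one_le_pow₀ hM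
  have hθ0 : 0 < θ := by positivity
  have hθ1 : θ ≤ 1 := by rw [hθ, div_le_one (by positivity)]; exact hM2
  have hθb : ∀ k a, θ * (iterM f (k + 1) [a]).length ≤ (iterM f k [x]).length := by
    intro k a
    have h1 : ((iterM f (k + 1) [a]).length : ℝ) ≤ (Mg f : ℝ) ^ 2 * (iterM f k [x]).length := by
      exact_mod_cast theta_bound f hf k a x
    rw [hθ, div_mul_eq_mul_div, one_mul, div_le_iff₀ (by positivity)]
    linarith
  have hex : ∀ k, ∃ V U : ℝ, V ≤ U ∧ U - V = (1 - θ / 2) ^ k * (2 * K) ∧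
      (∀ a, V * (iterM f k [a]).length ≤ asum ψ (iterM f k [a])) ∧
      (∀ a, asum ψ (iterM f k [a]) ≤ U * (iterM f k [a]).length) := by
    intro k
    induction k with
    | zero =>
      refine ⟨-K, K, by linarith, by ring, ?_, ?_⟩
      · intro a; have := abs_le.1 (hK a); simp [iterM_zero, asum]; linarith
      · intro a; have := abs_le.1 (hK a); simp [iterM_zero, asum]; linarith
    | succ k ih =>
      obtain ⟨V, U, h1, h2, h3, h4⟩ := ih
      obtain ⟨V', U', g1, g2, g3, g4⟩ := contraction f hf x ψ k θ V U hθ0.le (hθb k) h1 h3 h4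
      exact ⟨V', U', by linarith, by rw [g2, h2, pow_succ]; ring, g3, g4⟩
  have hVper : ∀ V k l, (∀ a, V * (iterM f k [a]).length ≤ asum ψ (iterM f k [a])) →
      (∀ a, V * (iterM f (k + l) [a]).length ≤ asum ψ (iterM f (k + l) [a])) := by
    intro V k l h a; rw [iterM_add]; exact lower_word' ψ f k V h _
  have hUper : ∀ V k l, (∀ a, asum ψ (iterM f k [a]) ≤ V * (iterM f k [a]).length) →
      (∀ a, asum ψ (iterM f (k + l) [a]) ≤ V * (iterM f (k + l) [a]).length) := by
    intro V k l h a; rw [iterM_add]; exact upper_word' ψ f k V h _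
  let A : Set ℝ := {V | ∃ k, ∀ a, V * (iterM f k [a]).length ≤ asum ψ (iterM f k [a])}
  have hVU : ∀ V ∈ A, ∀ U k, (∀ a, asum ψ (iterM f k [a]) ≤ U * (iterM f k [a]).length) →
      V ≤ U := by
    rintro V ⟨k, hk⟩ U l hl
    have h1 := hVper V k l hk x
    have h2 := hUper U l k hl x
    rw [add_comm] at h2
    have h3 : (1 : ℝ) ≤ (iterM f (k + l) [x]).length := by
      exact_mod_cast (by simpa using iterM_length_ge f hf.pos (k + l) [x])
    exact le_of_mul_le_mul_right (h1.trans h2) (by linarith)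
  refine ⟨sSup A, ?_⟩
  intro ε hε
  have hlim : Tendsto (fun k : ℕ => (1 - θ / 2) ^ k * (2 * K)) atTop (nhds (0 * (2 * K))) :=
    (tendsto_pow_atTop_nhds_zero_of_lt_one (by linarith) (by linarith)).mul_const _
  rw [zero_mul] at hlim
  obtain ⟨k, hk⟩ := (hlim.eventually (gt_mem_nhds hε)).exists
  obtain ⟨V, U, h1, h2, h3, h4⟩ := hex k
  refine ⟨k, fun w => ?_⟩
  have hVA : V ∈ A := ⟨k, h3⟩
  have hLV : V ≤ sSup A := le_csSup ⟨U, fun V' hV' => hVU V' hV' U k h4⟩ hVA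
  have hLU : sSup A ≤ U := csSup_le ⟨V, hVA⟩ fun V' hV' => hVU V' hV' U k h4
  rw [asum_sub, abs_le]
  have e1 := lower_word' ψ f k V h3 w
  have e2 := upper_word' ψ f k U h4 w
  have hl : (0 : ℝ) ≤ (iterM f k w).length := by positivity
  constructor <;> nlinarith

lemma freq_prefix [Fintype X] (f : X → List X) (hf : FullM f) (s : ℕ → X) (hs : FixW f s)
    (ψ : X → ℝ) :
    ∃ L : ℝ, ∀ ε > 0, ∃ C, ∀ t : ℕ, |asum ψ (pre s t) - L * t| ≤ ε * t + C := by
  obtain ⟨L, hL⟩ := freq_level f hf (s 0) ψ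
  refine ⟨L, fun ε hε => ?_⟩
  obtain ⟨k, hk⟩ := hL ε hε
  set ψ' : X → ℝ := fun a => ψ a - L with hψ'
  obtain ⟨K, hK⟩ : ∃ K : ℝ, ∀ a, |ψ' a| ≤ K :=
    ⟨∑ a, |ψ' a|, fun a => Finset.single_le_sum (f := fun a => |ψ' a|)
      (fun _ _ => abs_nonneg _) (Finset.mem_univ a)⟩
  have hK0 : 0 ≤ K := (abs_nonneg _).trans (hK (s 0))
  refine ⟨Mg (powM f k) * K, fun t => ?_⟩
  have e0 : asum ψ (pre s t) - L * t = asum ψ' (pre s t) := by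
    rw [hψ', asum_sub, pre_length]
  rw [e0]
  have hκ1 : ∀ a, 1 ≤ (powM f k a).length := fun a => by
    have h := iterM_length_ge f hf.pos k [a]
    exact h
  obtain ⟨r, z, rfl, hz⟩ := exists_pos (powM f k) s hκ1 t
  have h1 : |asum ψ' (pre s (pos (powM f k) s r))| ≤ ε * (pos (powM f k) s r : ℕ) := by
    have := hk (pre s r)
    rwa [hs.iter_pre, pre_length] at this
  have h2 : ∀ p z : ℕ, |asum ψ' (pre s (p + z))| ≤ |asum ψ' (pre s p)| + z * K := by
    intro p z
    induction z with
    | zero => simp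
    | succ z ih =>
      rw [← add_assoc, pre_succ, asum_append]
      have e1 := abs_add_le (asum ψ' (pre s (p + z))) (asum ψ' [s (p + z)])
      have e2 : asum ψ' [s (p + z)] = ψ' (s (p + z)) := by simp [asum]
      have e3 := hK (s (p + z))
      rw [← e2] at e3
      push_cast; linarith
  have h3 := h2 (pos (powM f k) s r) z
  have h4 : (z : ℝ) ≤ Mg (powM f k) := by
    exact_mod_cast hz.le.trans (length_le_Mg _ _)
  have h5 := mul_le_mul_of_nonneg_right h4 hK0
  have h6 : 0 ≤ ε * (z : ℝ) := by positivity
  push_cast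
  linarith

lemma asum_length (G : X → List X) (w : List X) :
    asum (fun a => ((G a).length : ℝ)) w = (applyM G w).length := by
  induction w with
  | nil => simp [asum, applyM]
  | cons a w ih => rw [asum_cons, applyM_cons, ih]; push_cast [List.length_append]; ring

lemma pos_le_Mg [Fintype X] (G : X → List X) (s : ℕ → X) (t : ℕ) : pos G s t ≤ Mg G * t := by
  have := applyM_length_le G (Mg G) (length_le_Mg G) (pre s t)
  rwa [pre_length] at this

/-- `pos (GH) - pos (HG)` is sublinear. -/
lemma dlt_sublinear [Fintype X] (G H : X → List X) (hG : FullM G) (s : ℕ → X)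
    (hsG : FixW G s) (hsH : FixW H s) (ε : ℝ) (hε : 0 < ε) :
    ∃ C : ℝ, ∀ t : ℕ, |(dlt (compM G H) (compM H G) s t : ℝ)| ≤ ε * t + C := by
  obtain ⟨ρ, hρ⟩ := freq_prefix G hG s hsG (fun a => ((G a).length : ℝ))
  obtain ⟨σ, hσ⟩ := freq_prefix G hG s hsG (fun a => ((H a).length : ℝ))
  simp only [asum_length] at hρ hσ
  set N : ℝ := Mg G + Mg H + |ρ| + |σ| + 1 with hN
  have hN0 : 0 < N := by positivity
  obtain ⟨C1, h1⟩ := hρ (ε / N) (by positivity)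
  obtain ⟨C2, h2⟩ := hσ (ε / N) (by positivity)
  refine ⟨C1 + |ρ| * C2 + C2 + |σ| * C1, fun t => ?_⟩
  have d : (dlt (compM G H) (compM H G) s t : ℝ) =
      pos G s (pos H s t) - pos H s (pos G s t) := by
    unfold dlt; rw [pos_compM hsH, pos_compM hsG]; push_cast; ring
  rw [d]
  have a1 := h1 (pos H s t)
  have a2 := h2 t
  have b1 := h2 (pos G s t)
  have b2 := h1 t
  change |(pos G s (pos H s t) : ℝ) - _| ≤ _ at a1
  change |(pos H s t : ℝ) - _| ≤ _ at a2
  change |(pos H s (pos G s t) : ℝ) - _| ≤ _ at b1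
  change |(pos G s t : ℝ) - _| ≤ _ at b2
  have k1 : (pos H s t : ℝ) ≤ Mg H * t := by exact_mod_cast pos_le_Mg H s t
  have k2 : (pos G s t : ℝ) ≤ Mg G * t := by exact_mod_cast pos_le_Mg G s t
  set δ := ε / N with hδ
  have hδ0 : 0 < δ := by positivity
  have hδN : δ * N = ε := by rw [hδ]; field_simp
  have e1 : (pos G s (pos H s t) : ℝ) - pos H s (pos G s t) =
    (pos G s (pos H s t) - ρ * pos H s t) + ρ * (pos H s t - σ * t)
    - ((pos H s (pos G s t) - σ * pos G s t) + σ * (pos G s t - ρ * t)) := by ring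
  rw [e1]
  have c1 : |ρ * (pos H s t - σ * t)| ≤ |ρ| * (δ * t + C2) := by
    rw [abs_mul]; exact mul_le_mul_of_nonneg_left a2 (abs_nonneg _)
  have c2 : |σ * (pos G s t - ρ * t)| ≤ |σ| * (δ * t + C1) := by
    rw [abs_mul]; exact mul_le_mul_of_nonneg_left b2 (abs_nonneg _)
  have c3 := abs_sub ((pos G s (pos H s t) - ρ * pos H s t) + ρ * (pos H s t - σ * t) : ℝ)
    ((pos H s (pos G s t) - σ * pos G s t) + σ * (pos G s t - ρ * t))
  have c4 := abs_add_le (pos G s (pos H s t) - ρ * pos H s t : ℝ) (ρ * (pos H s t - σ * t))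
  have c5 := abs_add_le (pos H s (pos G s t) - σ * pos G s t : ℝ) (σ * (pos G s t - ρ * t))
  have c6 := mul_le_mul_of_nonneg_left k1 hδ0.le
  have c7 := mul_le_mul_of_nonneg_left k2 hδ0.le
  have c8 : ε * t = δ * (Mg G * t) + δ * (Mg H * t) + |ρ| * (δ * t) + |σ| * (δ * t) + δ * t := by
    rw [← hδN, hN]; ring
  have c9 : 0 ≤ δ * t := by positivity
  rw [mul_add] at c1 c2
  linarith

/-- Length difference of images. -/
def phi (f f₂ : X → List X) (w : List X) : ℤ :=
  ((applyM f w).length : ℤ) - ((applyM f₂ w).length : ℤ)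

lemma comp_getElem? {f f₂ : X → List X} {w : List X} (h : w ∈ COMP f f₂) {i : ℕ}
    (h1 : i < (applyM f w).length) (h2 : i < (applyM f₂ w).length) :
    (applyM f w)[i]? = (applyM f₂ w)[i]? := by
  obtain ⟨u, v, h⟩ := h
  rw [← List.getElem?_append_left (l₂ := u) h1, ← List.getElem?_append_left (l₂ := v) h2, h]

lemma dlt_pow {f f₂ : X → List X} {s : ℕ → X} (hs : FixW f s) (j t : ℕ) :
    dlt (powM f (j + 1)) (compM f₂ (powM f j)) s t = dlt f f₂ s (pos (powM f j) s t) := by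
  unfold dlt
  rw [powM_succ, pos_compM (hs.pow j), pos_compM (hs.pow j)]

lemma dlt_le_mul (α β : X → List X) (s : ℕ → X) (K : ℕ)
    (hK : ∀ a, |((α a).length : ℤ) - (β a).length| ≤ K) (t : ℕ) : |dlt α β s t| ≤ t * K := by
  induction t with
  | zero => simp [dlt, pos_zero]
  | succ t ih =>
    have h : dlt α β s (t + 1) = dlt α β s t + (((α (s t)).length : ℤ) - (β (s t)).length) := by
      unfold dlt; rw [pos_succ, pos_succ]; push_cast; ring
    rw [h]
    have h1 := abs_add_le (dlt α β s t) (((α (s t)).length : ℤ) - (β (s t)).length)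
    have h2 := hK (s t)
    push_cast
    nlinarith

lemma csync [Fintype X] (f f₂ : X → List X) (hf : FullM f) (hf3 : ∀ a, 3 ≤ (f a).length)
    (s : ℕ → X) (hs : FixW f s) (hgr : ∀ N, ∃ k, N ≤ pos (powM f k) s 1)
    (N1 T i j D K : ℕ) (hN1 : N1 = Fintype.card X ^ 2 + 1) (hT : T = pos (powM f N1) s 1)
    (hj : j = i + 1 + N1)
    (hK : ∀ a, |phi f f₂ (iterM f j [a])| ≤ K) (hKD : T * K ≤ D)
    (hD3 : ∀ b, 3 * D ≤ (iterM f i [b]).length)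
    (hco : iterM f (j + N1) [s 0] ∈ COMP f f₂) :
    (FixW f₂ s ∧ ∀ t, |dlt f f₂ s (pos (powM f j) s t)| ≤ D) ∨
      (∃ P, 0 < P ∧ P ≤ 2 * D ∧ ∀ y, s (y + P) = s y) := by
  have hpair := pairs_aux f hf s hs hgr
  rw [← hN1, ← hT] at hpair
  have hpreT : iterM f N1 [s 0] = pre s T := by
    rw [hT, ← hs.iter_pre, pre_one]
  have hα : ∀ w, applyM (powM f (j + 1)) w = applyM f (iterM f j w) := fun w => by
    rw [applyM_powM, iterM_succ]
  have hβ : ∀ w, applyM (compM f₂ (powM f j)) w = applyM f₂ (iterM f j w) := fun w => by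
    rw [applyM_compM, applyM_powM]
  have hcomp : ∀ t < T, ∀ z < ((compM f₂ (powM f j)) (s t)).length,
      pos (compM f₂ (powM f j)) s t + z < pos (powM f (j + 1)) s T →
      ((compM f₂ (powM f j)) (s t))[z]? = some (s (pos (compM f₂ (powM f j)) s t + z)) := by
    intro t ht z hz hlt
    rw [iterM_add, hpreT] at hco
    have h2 : pos (compM f₂ (powM f j)) s t + z < (applyM f₂ (iterM f j (pre s T))).length := by
      rw [← hβ]
      have h3 := pos_mono (compM f₂ (powM f j)) s (Nat.succ_le_of_lt ht)
      rw [Nat.succ_eq_add_one, pos_succ] at h3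
      change _ < pos (compM f₂ (powM f j)) s T
      omega
    have h1 : pos (compM f₂ (powM f j)) s t + z < (applyM f (iterM f j (pre s T))).length := by
      rw [← hα]; exact hlt
    have h := comp_getElem? hco h1 h2
    rw [← hα, ← hβ, block_getElem? _ s ht hz, (hs.pow (j+1)) T, pre_getElem? _ _ _ hlt] at h
    exact h.symm
  have hD : ∀ t ≤ T, |dlt (powM f (j + 1)) (compM f₂ (powM f j)) s t| ≤ D := by
    intro t ht
    refine (dlt_le_mul _ _ s K (fun a => ?_) t).trans ?_
    · have := hK a
      unfold phi at this
      rwa [← hα, ← hβ, applyM_single, applyM_single] at this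
    · exact_mod_cast (Nat.mul_le_mul_right K ht).trans hKD
  have hmono : ∀ k b, i ≤ k → 3 * D ≤ (iterM f k [b]).length := by
    intro k b hk
    obtain ⟨m, rfl⟩ := Nat.exists_eq_add_of_le' hk
    rw [iterM_add]
    exact (hD3 b).trans (iterM_length_ge f hf.pos _ _)
  have h1len : ∀ k b, 1 ≤ (powM f k b).length := fun k b => iterM_length_ge f hf.pos k [b]
  have hblock : ∀ a, ∃ L R, powM f (j + 1) a = L ++ applyM (powM f i) (pre s T) ++ R ∧
      3 * D ≤ L.length ∧ 3 * D ≤ R.length := by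
    intro a
    obtain ⟨a1, a2, a3, r, hr⟩ : ∃ a1 a2 a3 r, f a = a1 :: a2 :: a3 :: r := by
      have := hf3 a
      match hfa : f a with
      | [] => simp [hfa] at this
      | [_] => simp [hfa] at this
      | [_, _] => simp [hfa] at this
      | a1 :: a2 :: a3 :: r => exact ⟨a1, a2, a3, r, rfl⟩
    obtain ⟨u, v, huv⟩ := List.append_of_mem (hf a2 (s 0))
    have e0 : powM f (j + 1) a = iterM f j [a1] ++ (iterM f j [a2] ++ (iterM f j [a3] ++
        iterM f j r)) := by
      change iterM f (j + 1) [a] = _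
      rw [iterM_succ', applyM_single, hr, ← iterM_append, ← iterM_append, ← iterM_append]; rfl
    have e1 : iterM f j [a2] = iterM f (i + N1) u ++ (applyM (powM f i) (pre s T) ++
        iterM f (i + N1) v) := by
      rw [show j = (i + N1) + 1 by omega, iterM_succ', applyM_single, huv, applyM_powM, ← hpreT,
        ← iterM_add, ← iterM_append, ← iterM_append]; rfl
    refine ⟨iterM f j [a1] ++ iterM f (i + N1) u,
      iterM f (i + N1) v ++ (iterM f j [a3] ++ iterM f j r), ?_, ?_, ?_⟩
    · rw [e0, e1]; simp only [List.append_assoc]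
    · have := hmono j a1 (by omega)
      rw [List.length_append]; omega
    · have := hmono j a3 (by omega)
      simp only [List.length_append]; omega
  rcases sync (powM f (j + 1)) (compM f₂ (powM f j)) (powM f i) s T D (hs.pow _) (hs.pow _)
    hpair hcomp hD (h1len i) hD3 hblock with hc | hP
  · left
    have hαD : ∀ b, D + 1 ≤ (powM f (j + 1) b).length := by
      intro b
      have e1 := hmono (j + 1) b (by omega)
      have e2 := h1len (j + 1) b
      change 3 * D ≤ (powM f (j + 1) b).length at e1
      omega
    have hfix := fix_of_consistent _ _ s T D (hs.pow (j + 1)) hpair hcomp hD hαD hc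
    refine ⟨fix_of_long fun t => ⟨pos (powM f j) s t, pos_ge _ s (h1len j) t,
      pos (compM f₂ (powM f j)) s t, ?_⟩, fun t => ?_⟩
    · have := hfix t
      rw [hβ, hs.iter_pre] at this
      rw [this]
    · obtain ⟨t0, h1, h2, -⟩ := hpair t
      rw [← dlt_pow hs, hc t t0 (by omega) h2]
      exact hD t0 (by omega)
  · exact Or.inr hP

lemma len_full [Fintype X] {f : X → List X} (hf : FullM f) (a : X) :
    Fintype.card X ≤ (f a).length := by
  classical
  have h1 : (Finset.univ : Finset X) ⊆ (f a).toFinset := fun b _ => by simpa using hf a b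
  exact (Finset.card_le_card h1).trans (List.toFinset_card_le _)

lemma full_comp {G H : X → List X} (hG : FullM G) (hH : FullM H) : FullM (compM G H) := by
  intro a b
  unfold compM
  rw [mem_applyM]
  exact ⟨a, hH a a, hG a b⟩

lemma conj_iter (G H : X → List X) (k : ℕ) (w : List X) :
    applyM H (iterM (compM G H) k w) = iterM (compM H G) k (applyM H w) := by
  induction k generalizing w with
  | zero => rfl
  | succ k ih => rw [iterM_succ', ih, iterM_succ', applyM_compM, applyM_compM]

lemma grow_pos [Fintype X] (f : X → List X) (hf : FullM f) (hM : 2 ≤ Mg f) (s : ℕ → X) :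
    ∀ N, ∃ k, N ≤ pos (powM f k) s 1 := by
  intro N
  have : Nonempty X := ⟨s 0⟩
  refine ⟨2 * N, ?_⟩
  have h := growth f hf N (s 0)
  have h2 : N < 2 ^ N := Nat.lt_two_pow_self
  have h3 := Nat.pow_le_pow_left hM N
  have h4 : pos (powM f (2 * N)) s 1 = (iterM f (2 * N) [s 0]).length := by
    unfold pos; rw [pre_one, applyM_powM]
  omega

lemma fix_half (G H : X → List X) (s : ℕ → X) (hf : FixW (compM G H) s)
    (hf₂ : FixW (compM H G) s) (hGx : [s 0] <+: G (s 0))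
    (hgr : ∀ N, ∃ k, N ≤ pos (powM (compM G H) k) s 1) : FixW H s := by
  refine fix_of_long fun t => ?_
  obtain ⟨k, hk⟩ := hgr t
  refine ⟨_, hk, pos (powM (compM H G) (k + 1)) s 1, ?_⟩
  rw [← hf.iter_pre, ← hf₂.iter_pre, conj_iter, iterM_succ', pre_one, applyM_single,
    applyM_single]
  apply iterM_prefix
  unfold compM
  have := applyM_prefix H hGx
  rwa [applyM_single] at this

lemma Mg_ge [Fintype X] (G H : X → List X) (hG : FullM G) (hH : FullM H) (a : X) :
    Fintype.card X ^ 2 ≤ (compM G H a).length := by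
  have h1 := applyM_length_ge' G (Fintype.card X) (len_full hG) (H a)
  have h2 := len_full hH a
  calc Fintype.card X ^ 2 = Fintype.card X * Fintype.card X := by ring
    _ ≤ Fintype.card X * (H a).length := Nat.mul_le_mul_left _ h2
    _ ≤ _ := h1

lemma f2_le [Fintype X] (G H : X → List X) (hG : FullM G) (hH : FullM H) (b : X) :
    (compM H G b).length ≤ Mg (compM G H) ^ 2 := by
  have h1 := iterM_length_le (compM G H) _ (length_le_Mg _) 2 [b]
  have h2 : iterM (compM G H) 2 [b] = applyM G (applyM (compM H G) (H b)) := by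
    rw [iterM_succ, iterM_succ, iterM_zero, applyM_single, applyM_compM, applyM_compM]; rfl
  rw [h2] at h1
  have h3 := applyM_length_ge G hG.pos (applyM (compM H G) (H b))
  have h4 := length_le_of_mem (compM H G) (hH b b)
  simp at h1
  omega

lemma phi_sum (f f₂ : X → List X) (w : List X) :
    ((phi f f₂ w : ℤ) : ℂ) =
      (w.map fun a => (((f a).length : ℂ) - ((f₂ a).length : ℂ))).sum := by
  induction w with
  | nil => simp [phi, applyM]
  | cons a w ih =>
    rw [List.map_cons, List.sum_cons, ← ih]
    unfold phi
    rw [applyM_cons, applyM_cons]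
    push_cast [List.length_append]
    ring

lemma phi_bound [Fintype X] (f f₂ : X → List X) (hBAL : BAL f f₂ < ⊤)
    (h1 : ∀ a, (f a).length ≤ Mg f ^ 2) (h2 : ∀ a, (f₂ a).length ≤ Mg f ^ 2) (k : ℕ) (a : X) :
    |phi f f₂ (iterM f k [a])| ≤
      ((Mg f ^ 2 * ((1 + k) * (Mg f + 1)) ^ (Fintype.card X) : ℕ) : ℤ) := by
  obtain ⟨B, hB⟩ := ENat.ne_top_iff_exists.mp hBAL.ne
  have hB' : ∀ k a, ‖((iterM f k [a]).map
      fun a => (((f a).length : ℂ) - ((f₂ a).length : ℂ))).sum‖ ≤ (B : ℝ) := by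
    intro k a
    rw [← phi_sum, Complex.norm_intCast]
    have h : (((phi f f₂ (iterM f k [a])).natAbs : ℕ) : ℕ∞) ≤ BAL f f₂ :=
      le_iSup₂_of_le (f := fun (x : X) (k : ℕ) =>
        ((((applyM f (iterM f k [x])).length : ℤ) -
        ((applyM f₂ (iterM f k [x])).length : ℤ)).natAbs : ℕ∞)) a k le_rfl
    rw [← hB] at h
    have h' : (phi f f₂ (iterM f k [a])).natAbs ≤ B := by exact_mod_cast h
    have h'' : |phi f f₂ (iterM f k [a])| ≤ (B : ℤ) := by
      rw [Int.abs_eq_natAbs]; exact_mod_cast h'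
    exact_mod_cast h''
  have hC : ∀ a, ‖(((f a).length : ℂ) - ((f₂ a).length : ℂ))‖ ≤ ((Mg f : ℝ) ^ 2) := by
    intro a
    have e : (((f a).length : ℂ) - ((f₂ a).length : ℂ)) =
      ((((f a).length : ℤ) - ((f₂ a).length : ℤ) : ℤ) : ℂ) := by push_cast; rfl
    rw [e, Complex.norm_intCast]
    have : |((f a).length : ℤ) - ((f₂ a).length : ℤ)| ≤ ((Mg f ^ 2 : ℕ) : ℤ) := by
      have e1 := h1 a
      have e2 := h2 a
      rw [abs_le]; constructor <;> omega
    exact_mod_cast this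
  have h := balance_bound f _ _ _ (by positivity) hC hB' k a
  rw [← phi_sum, Complex.norm_intCast] at h
  exact_mod_cast h

lemma comp_of_prefix {f f₂ : X → List X} {w w' : List X} (h : w' ∈ COMP f f₂) (hp : w <+: w') :
    w ∈ COMP f f₂ := by
  obtain ⟨u₁, u₂, h⟩ := h
  obtain ⟨r, rfl⟩ := hp
  refine ⟨applyM f r ++ u₁, applyM f₂ r ++ u₂, ?_⟩
  rw [applyM_append, applyM_append] at h
  simpa [List.append_assoc] using h

lemma backward [Fintype X] (n : ℕ) (hn : n = Fintype.card X) (hn2 : 2 ≤ n) (G H : X → List X)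
    (hG : FullM G) (hH : FullM H) (x : X) (hGx : [x] <+: G x) (hHx : [x] <+: H x)
    (hBAL : BAL (compM G H) (compM H G) < ⊤) (A : ℕ) (hA : 4 * n ^ 2 + 10 * n + 11 ≤ A)
    (hco : iterM (compM G H) A [x] ∈ COMP (compM G H) (compM H G)) :
    ∃ s : ℕ → X, s 0 = x ∧ FixW G s ∧ FixW H s := by
  have : Nonempty X := ⟨x⟩
  have hfull : FullM (compM G H) := full_comp hG hH
  have hfull₂ : FullM (compM H G) := full_comp hH hG
  have hn4 : 4 ≤ n ^ 2 := by nlinarith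
  have hMn : ∀ a, n ^ 2 ≤ (compM G H a).length := fun a => by rw [hn]; exact Mg_ge G H hG hH a
  have hMn2 : n ^ 2 ≤ Mg (compM H G) := by
    rw [hn]; exact (Mg_ge H G hH hG x).trans (length_le_Mg _ x)
  have hf2 := f2_le G H hG hH
  have hfx : [x] <+: compM G H x := by
    have := applyM_prefix G hHx
    rw [applyM_single] at this
    exact hGx.trans this
  have hM0 : n ^ 2 ≤ Mg (compM G H) := (hMn x).trans (length_le_Mg _ x)
  have hmain : ∃ s : ℕ → X, s 0 = x ∧ FixW (compM G H) s ∧ FixW (compM H G) s := by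
    generalize compM G H = f at *
    generalize compM H G = f₂ at *
    generalize hM : Mg f = M at *
    have hM4 : 4 ≤ M := hn4.trans hM0
    obtain ⟨s, hs0, hs, hpre⟩ := exists_omega f x hfx fun N => by
      refine ⟨2 * N, ?_⟩
      have h := growth f hfull N x
      rw [hM] at h
      have h2 : N < 2 ^ N := Nat.lt_two_pow_self
      have h3 : 2 ^ N ≤ M ^ N := Nat.pow_le_pow_left (by omega) N
      omega
    refine ⟨s, hs0, hs, ?_⟩
    subst hs0
    set N1 := n ^ 2 + 1 with hN1
    set E := N1 + 2 + 5 * n with hE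
    set i := 2 * (E + 1) with hi
    set j := i + 1 + N1 with hj
    have hgrow := growth f hfull
    rw [hM] at hgrow
    have hgr := grow_pos f hfull (by omega) s
    have hposlen : ∀ k, pos (powM f k) s 1 = (iterM f k [s 0]).length := fun k => by
      unfold pos; rw [pre_one, applyM_powM]
    have hmonoL : ∀ k l (b : X), k ≤ l → (iterM f k [b]).length ≤ (iterM f l [b]).length := by
      intro k l b hkl
      obtain ⟨m, rfl⟩ := Nat.exists_eq_add_of_le' hkl
      rw [iterM_add]
      exact iterM_length_ge f hfull.pos _ _
    have hTle : pos (powM f N1) s 1 ≤ M ^ N1 := by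
      rw [hposlen]
      have := iterM_length_le f M (fun a => hM ▸ length_le_Mg f a) N1 [s 0]
      simpa using this
    have hM1 : ∀ a, (f a).length ≤ M ^ 2 := fun a => by
      have := length_le_Mg f a
      rw [hM] at this
      nlinarith
    have hK : ∀ a, |phi f f₂ (iterM f j [a])| ≤ ((M ^ (2 + 5 * n) : ℕ) : ℤ) := by
      intro a
      have h := phi_bound f f₂ hBAL (by rwa [hM]) (by rwa [hM]) j a
      rw [hM, ← hn] at h
      refine h.trans ?_
      norm_cast
      have e1 : 1 + j ≤ M ^ 3 := by
        have : (n ^ 2) ^ 3 ≤ M ^ 3 := Nat.pow_le_pow_left hM0 3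
        have e : 1 + j ≤ (n ^ 2) ^ 3 := by
          have : 16 * n ^ 2 ≤ (n ^ 2) ^ 3 := by
            have : 4 * 4 * n ^ 2 ≤ n ^ 2 * n ^ 2 * n ^ 2 := by gcongr
            linarith [show (n ^ 2) ^ 3 = n ^ 2 * n ^ 2 * n ^ 2 by ring]
          have : 1 + j = 3 * n ^ 2 + 10 * n + 11 := by omega
          nlinarith
        omega
      have e2 : M + 1 ≤ M ^ 2 := by nlinarith
      calc M ^ 2 * ((1 + j) * (M + 1)) ^ n ≤ M ^ 2 * (M ^ 3 * M ^ 2) ^ n := by gcongr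
        _ = M ^ (2 + 5 * n) := by rw [← pow_add, ← pow_mul, ← pow_add]
    have h4D : 4 * M ^ E ≤ M ^ (E + 1) := by
      rw [pow_succ, mul_comm]; exact Nat.mul_le_mul_left _ hM4
    have hco' : iterM f (j + N1) [s 0] ∈ COMP f f₂ := by
      refine comp_of_prefix hco ?_
      have hle : j + N1 ≤ A := by
        have : j + N1 = 4 * n ^ 2 + 10 * n + 11 := by omega
        omega
      rw [hpre, hpre A]
      exact pre_prefix s (hmonoL _ _ _ hle)
    rcases csync f f₂ hfull (fun a => by have := hMn a; omega) s hs hgr N1 _ i j (M ^ E)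
      (M ^ (2 + 5 * n)) (by rw [hN1, hn]) rfl hj hK
      (by
        calc pos (powM f N1) s 1 * M ^ (2 + 5 * n) ≤ M ^ N1 * M ^ (2 + 5 * n) := by gcongr
          _ = M ^ E := by rw [← pow_add, hE]; congr 1; ring)
      (fun b => by have := hgrow (E + 1) b; rw [← hi] at this; omega) hco' with hc | ⟨P, hP0, hP, hper⟩
    · exact hc.1
    · refine fix_of_periodic f₂ s P hP0 hper hfull₂.pos ?_
      intro t ht z hz
      set L := (iterM f (j + N1) [s 0]).length with hL
      have hLP : 2 * P ≤ L := by
        have e1 := hgrow (E + 1) (s 0)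
        have e2 := hmonoL (2 * (E + 1)) (j + N1) (s 0) (by omega)
        omega
      have hLP2 : pos f₂ s (2 * P) ≤ pos f s L := by
        have e1 := hgrow (E + 3) (s 0)
        have e2 := hmonoL (2 * (E + 3)) (j + N1 + 1) (s 0) (by omega)
        have e3 : pos f s L = (iterM f (j + N1 + 1) [s 0]).length := by
          unfold pos; rw [← hpre, iterM_succ]
        have e4 : pos f₂ s (2 * P) ≤ M ^ 2 * (2 * P) := by
          have := applyM_length_le f₂ _ hf2 (pre s (2 * P))
          rwa [pre_length] at this
        have e5 : M ^ 2 * (2 * P) ≤ M ^ 2 * M ^ (E + 1) := Nat.mul_le_mul_left _ (by omega)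
        have e6 : M ^ 2 * M ^ (E + 1) = M ^ (E + 3) := by rw [← pow_add]; congr 1; ring
        omega
      have hlt : pos f₂ s t + z < pos f₂ s (2 * P) := by
        have h3 := pos_mono f₂ s (Nat.succ_le_of_lt ht)
        rw [Nat.succ_eq_add_one, pos_succ] at h3
        omega
      have hlt2 := pos_mono f₂ s hLP
      rw [hpre, ← hL] at hco'
      have h := comp_getElem? hco' (i := pos f₂ s t + z)
        (by change _ < pos f s L; omega) (by change _ < pos f₂ s L; omega)
      rw [block_getElem? _ s (by omega) hz, hs L, pre_getElem? _ _ _ (by omega)] at h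
      exact h.symm
  obtain ⟨s, rfl, h1, h2⟩ := hmain
  exact ⟨s, rfl, fix_half H G s h2 h1 hHx (grow_pos _ hfull₂ (by omega) s),
    fix_half G H s h1 h2 hGx (grow_pos _ hfull (by omega) s)⟩

lemma phi_append (f f₂ : X → List X) (u v : List X) :
    phi f f₂ (u ++ v) = phi f f₂ u + phi f f₂ v := by
  unfold phi
  rw [applyM_append, applyM_append]
  push_cast [List.length_append]
  ring

lemma phi_diff (f f₂ : X → List X) (s : ℕ → X) (hs : FixW f s) (k t : ℕ) :
    phi f f₂ (iterM f k [s t]) =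
      dlt f f₂ s (pos (powM f k) s (t + 1)) - dlt f f₂ s (pos (powM f k) s t) := by
  have h : ∀ y, dlt f f₂ s y = phi f f₂ (pre s y) := fun y => rfl
  rw [h, h, ← hs.iter_pre, ← hs.iter_pre, pre_succ, iterM_append, phi_append]
  ring

lemma exists_letter {f : X → List X} (hf : FullM f) {s : ℕ → X} (hs : FixW f s) (a : X) :
    ∃ t < pos f s 1, s t = a := by
  have h := hs 1
  rw [pre_one, applyM_single] at h
  have h1 := hf (s 0) a
  rw [h, List.mem_iff_getElem?] at h1
  obtain ⟨i, hi⟩ := h1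
  have hlt : i < pos f s 1 := by
    by_contra hcon
    rw [List.getElem?_eq_none (by rw [pre_length]; omega)] at hi
    cases hi
  rw [pre_getElem? _ _ _ hlt] at hi
  exact ⟨i, hlt, by simpa using hi⟩

lemma BAL_lt [Fintype X] (f f₂ : X → List X) (hf : FullM f) (s : ℕ → X) (hs : FixW f s) (B : ℕ)
    (hB : ∀ t, |dlt f f₂ s t| ≤ B) : BAL f f₂ < ⊤ := by
  refine lt_of_le_of_lt (b := ((2 * B : ℕ) : ℕ∞)) ?_ (ENat.natCast_lt_top _)
  refine iSup₂_le fun a k => ?_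
  obtain ⟨t, -, rfl⟩ := exists_letter hf hs a
  have h : |phi f f₂ (iterM f k [s t])| ≤ 2 * B := by
    rw [phi_diff f f₂ s hs, abs_le]
    have h1 := abs_le.mp (hB (pos (powM f k) s (t + 1)))
    have h2 := abs_le.mp (hB (pos (powM f k) s t))
    constructor <;> linarith
  have h' : (phi f f₂ (iterM f k [s t])).natAbs ≤ 2 * B := by
    rw [Int.abs_eq_natAbs] at h; exact_mod_cast h
  exact Nat.cast_le.mpr h'

lemma comp_pre {f f₂ : X → List X} {s : ℕ → X} (h1 : FixW f s) (h2 : FixW f₂ s) (t : ℕ) :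
    pre s t ∈ COMP f f₂ := by
  unfold COMP
  rw [Set.mem_ofPred_eq, h1 t, h2 t]
  rcases le_total (pos f s t) (pos f₂ s t) with h | h
  · obtain ⟨r, hr⟩ := pre_prefix s h
    exact ⟨r, [], by simpa using hr⟩
  · obtain ⟨r, hr⟩ := pre_prefix s h
    exact ⟨[], r, by simpa using hr.symm⟩

lemma dlt_add_le [Fintype X] (f f₂ : X → List X) (s : ℕ → X) (p z : ℕ) :
    |dlt f f₂ s (p + z)| ≤ |dlt f f₂ s p| + z * (Mg f + Mg f₂ : ℕ) := by
  induction z with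
  | zero => simp
  | succ z ih =>
    have h : dlt f f₂ s (p + z + 1) = dlt f f₂ s (p + z) +
        (((f (s (p + z))).length : ℤ) - (f₂ (s (p + z))).length) := by
      unfold dlt; rw [pos_succ, pos_succ]; push_cast; ring
    rw [← add_assoc, h]
    have h1 := abs_add_le (dlt f f₂ s (p + z))
      (((f (s (p + z))).length : ℤ) - (f₂ (s (p + z))).length)
    have e1 := length_le_Mg f (s (p + z))
    have e2 := length_le_Mg f₂ (s (p + z))
    have h2 : |((f (s (p + z))).length : ℤ) - (f₂ (s (p + z))).length| ≤ (Mg f + Mg f₂ : ℕ) := by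
      rw [abs_le]; constructor <;> omega
    push_cast at *
    linarith

lemma forward [Fintype X] (hn2 : 2 ≤ Fintype.card X) (G H : X → List X)
    (hG : FullM G) (hH : FullM H) (s : ℕ → X) (hsG : FixW G s) (hsH : FixW H s) :
    BAL (compM G H) (compM H G) < ⊤ := by
  have hfull : FullM (compM G H) := full_comp hG hH
  have hsub := dlt_sublinear G H hG s hsG hsH
  have hs : FixW (compM G H) s := hsG.comp hsH
  have hs₂ : FixW (compM H G) s := hsH.comp hsG
  have hMn := Mg_ge G H hG hH
  have hn4 : 4 ≤ Fintype.card X ^ 2 := by nlinarith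
  generalize compM G H = f at *
  generalize compM H G = f₂ at *
  have hne : Nonempty X := ⟨s 0⟩
  have hM4 : 4 ≤ Mg f := hn4.trans ((hMn (s 0)).trans (length_le_Mg _ _))
  have hgr := grow_pos f hfull (by omega) s
  obtain ⟨N1, hN1⟩ : ∃ N1, N1 = Fintype.card X ^ 2 + 1 := ⟨_, rfl⟩
  obtain ⟨T, hT⟩ : ∃ T, T = pos (powM f N1) s 1 := ⟨_, rfl⟩
  obtain ⟨R, hR⟩ : ∃ R, R = Mg f ^ 2 * (iterM f (N1 + 2) [s 0]).length := ⟨_, rfl⟩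
  obtain ⟨C, hC⟩ := hsub (1 / (12 * T * R + 1)) (by positivity)
  obtain ⟨c, hc⟩ := exists_nat_ge (12 * T * C)
  obtain ⟨i, hi⟩ : ∃ i, ∀ b, c ≤ (iterM f i [b]).length := by
    refine ⟨2 * c, fun b => ?_⟩
    have h := growth f hfull c b
    have h2 : c < 2 ^ c := Nat.lt_two_pow_self
    have h3 : 2 ^ c ≤ Mg f ^ c := Nat.pow_le_pow_left (by omega) c
    omega
  obtain ⟨j, hj⟩ : ∃ j, j = i + 1 + N1 := ⟨_, rfl⟩
  have hlen : ∀ b, pos (powM f j) s (pos f s 1) ≤ R * (iterM f i [b]).length := by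
    intro b
    have e0 : pos (powM f j) s (pos f s 1) = (iterM f i (iterM f (N1 + 2) [s 0])).length := by
      rw [← pos_compM hs]
      unfold pos
      rw [pre_one, applyM_compM, applyM_powM, ← iterM_add, ← iterM_succ',
        show j + 1 = i + (N1 + 2) by omega]
    have e1 := iter_cmp f hfull i (iterM f (N1 + 2) [s 0]) b
    have e2 := theta_bound f hfull i b b
    rw [e0, hR]
    calc _ ≤ _ := e1
      _ ≤ (Mg f ^ 2 * (iterM f i [b]).length) * (iterM f (N1 + 2) [s 0]).length := by gcongr
      _ = _ := by ring
  have hphi : ∀ a b, 3 * ((T : ℝ) * |((phi f f₂ (iterM f j [a]) : ℤ) : ℝ)|) ≤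
      (iterM f i [b]).length := by
    intro a b
    obtain ⟨t, ht, rfl⟩ := exists_letter hfull hs a
    have hbd : ∀ y ≤ pos f s 1, |(dlt f f₂ s (pos (powM f j) s y) : ℝ)| ≤
        1 / (12 * T * R + 1) * (R * (iterM f i [b]).length) + C := by
      intro y hy
      refine (hC _).trans ?_
      have : ((pos (powM f j) s y : ℕ) : ℝ) ≤ R * (iterM f i [b]).length := by
        exact_mod_cast (pos_mono _ s hy).trans (hlen b)
      gcongr
    have h1 := hbd t ht.le
    have h2 := hbd (t + 1) ht
    rw [phi_diff f f₂ s hs]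
    push_cast
    have h3 := abs_sub (dlt f f₂ s (pos (powM f j) s (t + 1)) : ℝ)
      (dlt f f₂ s (pos (powM f j) s t))
    have hcb : (c : ℝ) ≤ (iterM f i [b]).length := by exact_mod_cast hi b
    set ℓ : ℝ := ((iterM f i [b]).length : ℝ) with hℓ
    have hℓ0 : 0 ≤ ℓ := by positivity
    have h4 : (12 * T * R : ℝ) * (1 / (12 * T * R + 1)) ≤ 1 := by
      rw [mul_one_div, div_le_one (by positivity)]; linarith
    have h5 := mul_le_mul_of_nonneg_right h4 hℓ0
    have hT0 : (0 : ℝ) ≤ T := by positivity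
    have h6 := mul_le_mul_of_nonneg_left (h3.trans (add_le_add h2 h1)) hT0
    nlinarith
  obtain ⟨K, hK, b0, hb0⟩ : ∃ K : ℕ, (∀ a, |phi f f₂ (iterM f j [a])| ≤ K) ∧
      ∃ a, |phi f f₂ (iterM f j [a])| = K := by
    obtain ⟨a, ha⟩ := Finite.exists_max fun a => |phi f f₂ (iterM f j [a])|
    refine ⟨(phi f f₂ (iterM f j [a])).natAbs, fun b => ?_, a, ?_⟩
    · rw [← Int.abs_eq_natAbs]; exact ha b
    · rw [← Int.abs_eq_natAbs]
  have hD3 : ∀ b, 3 * (T * K) ≤ (iterM f i [b]).length := by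
    intro b
    have h := hphi b0 b
    rw [← Int.cast_abs, hb0] at h
    exact_mod_cast h
  have hco : iterM f (j + N1) [s 0] ∈ COMP f f₂ := by
    rw [← pre_one, hs.iter_pre]; exact comp_pre hs hs₂ _
  rcases csync f f₂ hfull (fun a => by have := hMn a; omega) s hs hgr N1 T i j (T * K) K hN1 hT hj
    hK le_rfl hD3 hco with ⟨-, hc⟩ | ⟨P, hP0, -, hper⟩
  · refine BAL_lt f f₂ hfull s hs (T * K + Mg (powM f j) * (Mg f + Mg f₂)) fun y => ?_
    have h1len : ∀ b, 1 ≤ (powM f j b).length := fun b => iterM_length_ge f hfull.pos j [b]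
    obtain ⟨t, z, rfl, hz⟩ := exists_pos (powM f j) s h1len y
    refine (dlt_add_le f f₂ s _ z).trans ?_
    have h1 := hc t
    have h2 : z * (Mg f + Mg f₂) ≤ Mg (powM f j) * (Mg f + Mg f₂) :=
      Nat.mul_le_mul_right _ (hz.le.trans (length_le_Mg _ _))
    have h3 : ((z * (Mg f + Mg f₂) : ℕ) : ℤ) ≤ (Mg (powM f j) * (Mg f + Mg f₂) : ℕ) := by
      exact_mod_cast h2
    push_cast at *
    linarith
  · have hadd : ∀ k t : ℕ, dlt f f₂ s (t + k * P) = dlt f f₂ s t + k * dlt f f₂ s P := by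
      intro k t
      unfold dlt
      rw [pos_periodic_mul f s P hper, pos_periodic_mul f₂ s P hper]
      push_cast; ring
    have hzero : dlt f f₂ s P = 0 := by
      by_contra hne0
      have hP' : (0 : ℝ) < P := by exact_mod_cast hP0
      obtain ⟨C', hC'⟩ := hsub (1 / (2 * P)) (by positivity)
      obtain ⟨k, hk⟩ := exists_nat_gt (2 * C')
      have h := hC' (0 + k * P)
      rw [hadd] at h
      have h0 : dlt f f₂ s 0 = 0 := by simp [dlt, pos_zero]
      rw [h0, zero_add, zero_add] at h
      have h1 : (1 : ℝ) ≤ |(dlt f f₂ s P : ℝ)| := by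
        rw [← Int.cast_abs]; exact_mod_cast Int.one_le_abs hne0
      push_cast at h
      rw [abs_mul, Nat.abs_cast] at h
      have h2 : 1 / (2 * (P : ℝ)) * (k * P) = k / 2 := by field_simp
      rw [h2] at h
      have h3 : (k : ℝ) * 1 ≤ k * |(dlt f f₂ s P : ℝ)| := by gcongr
      linarith
    refine BAL_lt f f₂ hfull s hs (P * (Mg f + Mg f₂)) fun t => ?_
    have h := hadd (t / P) (t % P)
    rw [Nat.mod_add_div', hzero, mul_zero, add_zero] at h
    rw [h]
    have h1 := dlt_add_le f f₂ s 0 (t % P)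
    have h0 : dlt f f₂ s 0 = 0 := by simp [dlt, pos_zero]
    rw [h0, zero_add, abs_zero, zero_add] at h1
    refine h1.trans ?_
    exact_mod_cast Nat.mul_le_mul_right _ (Nat.mod_lt t hP0).le

lemma prefix_iter (g : X → List X) (x : X) (hx : [x] <+: g x) (k : ℕ) :
    [x] <+: iterM g k [x] := by
  induction k with
  | zero => exact List.prefix_rfl
  | succ k ih =>
    rw [iterM_succ]
    have := applyM_prefix g ih
    rw [applyM_single] at this
    exact hx.trans this

lemma omega_fix {g : X → List X} {x : X} {s : ℕ → X} (h : IsOmega g x s) :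
    s 0 = x ∧ FixW g s := by
  obtain ⟨⟨h1, h2⟩, h3⟩ := h
  constructor
  · have := h3 0 0 (by simp [iterM_zero])
    simpa [iterM_zero] using this.symm
  · refine fix_of_long fun t => ?_
    obtain ⟨k, hk⟩ := (h2.eventually_ge_atTop t).exists
    refine ⟨_, hk, (iterM g (k + 1) [x]).length, ?_⟩
    rw [← (isPrefI_iff _ _).mp (h3 k), ← (isPrefI_iff _ _).mp (h3 (k + 1)), iterM_succ]

lemma fix_unique [Fintype X] (G : X → List X) (hG : FullM G) (hM : 2 ≤ Mg G) (s s' : ℕ → X)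
    (hs : FixW G s) (hs' : FixW G s') (h0 : s 0 = s' 0) : s = s' := by
  funext t
  obtain ⟨k, hk⟩ := grow_pos G hG hM s (t + 1)
  have h1 : pre s (pos (powM G k) s 1) = pre s' (pos (powM G k) s' 1) := by
    rw [← hs.iter_pre, ← hs'.iter_pre, pre_one, pre_one, h0]
  have h2 : pos (powM G k) s 1 = pos (powM G k) s' 1 := by
    unfold pos; rw [pre_one, pre_one, h0]
  have h3 := congrArg (fun l => l[t]?) h1
  rw [pre_getElem? _ _ _ (by omega), pre_getElem? _ _ _ (by omega)] at h3
  simpa using h3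

lemma Abound_ge (n : ℕ) (hn2 : 2 ≤ n) : 4 * n ^ 2 + 10 * n + 11 ≤ Abound n := by
  unfold Abound
  apply Nat.le_floor
  have hn : (2 : ℝ) ≤ n := by exact_mod_cast hn2
  have hlog : (1 : ℝ) / 2 ≤ Real.log n := by
    have h1 := Real.log_two_gt_d9
    have h2 := Real.log_le_log (by norm_num) hn
    linarith
  have h1 : (1 : ℝ) ≤ Real.sqrt (n * Real.log n) := by
    rw [Real.one_le_sqrt]
    nlinarith
  have h2 : (4 * n ^ 2 + 10 * n + 11 : ℝ) ≤ 9 * (n : ℝ) ^ 3 := by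
    have e1 : (n : ℝ) ^ 2 * 2 ≤ n ^ 2 * n := by gcongr
    nlinarith
  push_cast
  calc _ ≤ 9 * (n : ℝ) ^ 3 * 1 := by linarith
    _ ≤ _ := by gcongr

/-- (Theorem 15 of the paper.) Let `g, h` be primitive with
`g^ω(x)` and `h^ω(x)` existing, and set `f₁ = g^{2n-2} h^{2n-2}`,
`f₂ = h^{2n-2} g^{2n-2}`.  Then `g^ω(x) = h^ω(x)` iff `BAL(f₁,f₂) < ∞` and
`f₁^{A(n)}(x) ∈ COMP(f₁,f₂)`, where `A(n) = ⌊9n³√(n log n)⌋`. -/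
theorem primitive_equality_criterion {X : Type*} [Fintype X]
    (n : ℕ) (hn : n = Fintype.card X) (hn2 : 2 ≤ n)
    (g h : X → List X) (hg : Primitive g) (hh : Primitive h)
    (x : X) (sg sh : ℕ → X) (hsg : IsOmega g x sg) (hsh : IsOmega h x sh)
    (f₁ f₂ : X → List X)
    (hf₁ : f₁ = compM (powM g (2 * n - 2)) (powM h (2 * n - 2)))
    (hf₂ : f₂ = compM (powM h (2 * n - 2)) (powM g (2 * n - 2))) :
    sg = sh ↔ (BAL f₁ f₂ < ⊤ ∧ iterM f₁ (Abound n) [x] ∈ COMP f₁ f₂) := by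
  classical
  obtain ⟨hg0, hgf⟩ := omega_fix hsg
  obtain ⟨hh0, hhf⟩ := omega_fix hsh
  have hgx := hsg.1.1
  have hhx := hsh.1.1
  have hG := full_of_primitive g hg x hgx n hn (by omega)
  have hH := full_of_primitive h hh x hhx n hn (by omega)
  have hGx : [x] <+: powM g (2 * n - 2) x := prefix_iter g x hgx _
  have hHx : [x] <+: powM h (2 * n - 2) x := prefix_iter h x hhx _
  have hGf := hgf.pow (2 * n - 2)
  have hHf := hhf.pow (2 * n - 2)
  subst hf₁ hf₂
  generalize powM g (2 * n - 2) = G at *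
  generalize powM h (2 * n - 2) = H at *
  have hMG : 2 ≤ Mg G := (hn ▸ hn2).trans ((len_full hG x).trans (length_le_Mg _ _))
  have hMH : 2 ≤ Mg H := (hn ▸ hn2).trans ((len_full hH x).trans (length_le_Mg _ _))
  constructor
  · rintro rfl
    refine ⟨forward (hn ▸ hn2) G H hG hH sg hGf hHf, ?_⟩
    have h1 : FixW (compM G H) sg := hGf.comp hHf
    rw [← hg0, ← pre_one, h1.iter_pre]
    exact comp_pre h1 (hHf.comp hGf) _
  · rintro ⟨hB, hco⟩
    obtain ⟨s, hs0, hsG, hsH⟩ := backward n hn hn2 G H hG hH x hGx hHx hB _ (Abound_ge n hn2) hco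
    rw [fix_unique G hG hMG sg s hGf hsG (by rw [hg0, hs0]),
      fix_unique H hH hMH sh s hHf hsH (by rw [hh0, hs0])]
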